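/- arXiv:1910.05160 — 5 statements merged into one kernel-verified Lean document; each statement's English description precedes it below -/
import Mathlib

section
/- Let n ≥ 3. There exists a constant C > 0 depending only on n such that for every s ∈ (0,2), every R ≥ 1, and every continuously differentiable function u : ℝ^n → ℝ whose support is a compact subset of the open half-ball B_R^+, one has (∫_{B_R^+} |u(x)|^{2(n−s)/(n−2)} x_n^{−s} dx)^{(n−2)/(n−s)} ≤ C^{(n−2)/(n−s)} ∫_{B_R^+} |∇u(x)|² dx. -/
open MeasureTheory Real Set

noncomputable section

/-- The last coordinate of a point of `ℝⁿ`. -/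
def lastC {n : ℕ} (x : EuclideanSpace ℝ (Fin n)) : ℝ :=
  if h : 0 < n then x ⟨n - 1, by omega⟩ else 0

/-- The open upper half ball `B_R^+ = {x : |x| < R, x_n > 0}`. -/
def halfBall (n : ℕ) (R : ℝ) : Set (EuclideanSpace ℝ (Fin n)) :=
  {x | ‖x‖ < R ∧ 0 < lastC x}

/-- Hardy's inequality for `u = w * L`, with `L` a linear form and `L e = 1`. -/
theorem integral_sq_le_of_mul_linear {E : Type*} [NormedAddCommGroup E] [InnerProductSpace ℝ E]
    [FiniteDimensional ℝ E] [MeasurableSpace E] [BorelSpace E] {μ : Measure E}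
    [μ.IsAddHaarMeasure] (L : E →L[ℝ] ℝ) {e : E} (he : L e = 1) {w : E → ℝ}
    (hw : ContDiff ℝ 1 w) (hwc : HasCompactSupport w) :
    ∫ x, w x ^ 2 ∂μ ≤ 4 * ∫ x, (fderiv ℝ (fun y ↦ w y * L y) x e) ^ 2 ∂μ := by
  have hdiff : Differentiable ℝ w := hw.differentiable one_ne_zero
  have hw' : Continuous fun x ↦ fderiv ℝ w x e :=
    (hw.continuous_fderiv one_ne_zero).clm_apply continuous_const
  have hwcont := hw.continuous
  have hu (x : E) : fderiv ℝ (fun y ↦ w y * L y) x e = w x + fderiv ℝ w x e * L x := by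
    rw [fderiv_fun_mul (hdiff x) L.differentiableAt]
    simp [he, mul_comm]
  simp_rw [hu]
  have hwc2 : HasCompactSupport fun x ↦ w x * w x := hwc.mul_left
  have hw'c : HasCompactSupport fun x ↦ fderiv ℝ w x e :=
    hwc.fderiv_apply ℝ e
  have hsq (x : E) : fderiv ℝ (fun y ↦ w y * w y) x e = 2 * (w x * fderiv ℝ w x e) := by
    rw [fderiv_fun_mul (hdiff x) (hdiff x)]
    simp; ring
  have hint1 : Integrable (fun x ↦ w x ^ 2) μ := by
    simp_rw [sq]
    exact (hwcont.mul hwcont).integrable_of_hasCompactSupport hwc2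
  have hint2 : Integrable (fun x ↦ 2 * (w x * fderiv ℝ w x e) * L x) μ := by
    refine Continuous.integrable_of_hasCompactSupport (by fun_prop) ?_
    exact (hwc.mul_right.mul_left (f := fun _ ↦ (2 : ℝ))).mul_right
  have hint3 : Integrable (fun x ↦ (w x + fderiv ℝ w x e * L x) ^ 2) μ := by
    refine Continuous.integrable_of_hasCompactSupport (by fun_prop) ?_
    exact (hwc.add hw'c.mul_right).comp_left (g := fun t : ℝ ↦ t ^ 2) (by simp)
  have hparts := integral_mul_fderiv_eq_neg_fderiv_mul_of_integrable (μ := μ) (v := e)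
    (f := fun x ↦ w x * w x) (g := L) (by simpa only [hsq] using hint2)
    (by simpa [he, ← sq] using hint1)
    ((hwcont.mul hwcont).mul L.continuous |>.integrable_of_hasCompactSupport hwc2.mul_right)
    (fun x _ ↦ (hdiff x).mul (hdiff x)) (fun x _ ↦ L.differentiableAt)
  simp only [ContinuousLinearMap.fderiv, he, mul_one, hsq] at hparts
  simp only [← sq] at hparts
  have key : ∫ x, (2 * w x ^ 2 + 2 * (w x * fderiv ℝ w x e) * L x) ∂μ
      ≤ ∫ x, (1 / 2 * w x ^ 2 + 2 * (w x + fderiv ℝ w x e * L x) ^ 2) ∂μ := by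
    refine integral_mono ((hint1.const_mul 2).add hint2)
      ((hint1.const_mul _).add (hint3.const_mul _)) fun x ↦ ?_
    nlinarith [sq_nonneg (w x - 2 * (w x + fderiv ℝ w x e * L x))]
  rw [integral_add (hint1.const_mul 2) hint2,
    integral_add (hint1.const_mul _) (hint3.const_mul _)] at key
  simp only [integral_const_mul] at key
  linarith

open Module in
open scoped NNReal in
theorem exists_integral_rpow_le_of_sobolev {E : Type*} [NormedAddCommGroup E]
    [InnerProductSpace ℝ E] [FiniteDimensional ℝ E] [MeasurableSpace E] [BorelSpace E]
    (μ : Measure E) [μ.IsAddHaarMeasure] (hE : 3 ≤ finrank ℝ E) :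
    ∃ K : ℝ, 0 < K ∧ ∀ u : E → ℝ, ContDiff ℝ 1 u → HasCompactSupport u →
      ∫ x, |u x| ^ (2 * (finrank ℝ E : ℝ) / (finrank ℝ E - 2)) ∂μ ≤
        K * (∫ x, ‖fderiv ℝ u x‖ ^ 2 ∂μ) ^ ((finrank ℝ E : ℝ) / (finrank ℝ E - 2)) := by
  set N : ℝ := (finrank ℝ E : ℝ) with hN
  have hN3 : 3 ≤ N := by rw [hN]; exact_mod_cast hE
  set q : ℝ := 2 * N / (N - 2) with hq
  have hN2 : 0 < N - 2 := by linarith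
  have hq0 : 0 < q := by positivity
  set c : ℝ≥0 := SNormLESNormFDerivOfEqConst ℝ μ ((2 : ℝ≥0) : ℝ) with hc
  refine ⟨(c : ℝ) ^ q + 1, by positivity, fun u hu huc ↦ ?_⟩
  set D := ∫ x, ‖fderiv ℝ u x‖ ^ 2 ∂μ with hD
  have hD0 : 0 ≤ D := integral_nonneg fun x ↦ by positivity
  have h := eLpNorm_le_eLpNorm_fderiv_of_eq (μ := μ) hu huc (p := 2) (p' := q.toNNReal)
    (by norm_num) (by omega) (by
      rw [Real.coe_toNNReal _ hq0.le, hq, ← hN]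
      push_cast; field_simp)
  have hm1 : MemLp u (q.toNNReal) μ := hu.continuous.memLp_of_hasCompactSupport huc
  have hm2 : MemLp (fderiv ℝ u) 2 μ :=
    (hu.continuous_fderiv one_ne_zero).memLp_of_hasCompactSupport (huc.fderiv ℝ)
  have hI0 : 0 ≤ ∫ x, |u x| ^ q ∂μ := integral_nonneg fun x ↦ by positivity
  rw [hm1.eLpNorm_eq_integral_rpow_norm (by simpa using hq0) (by simp), ENNReal.coe_ofNat,
    hm2.eLpNorm_eq_integral_rpow_norm (by simp) (by simp), ← hc, ← ENNReal.ofReal_coe_nnreal (p := c),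
    ← ENNReal.ofReal_mul (by positivity), ENNReal.ofReal_le_ofReal_iff (by positivity)] at h
  simp only [ENNReal.coe_toReal, Real.coe_toNNReal _ hq0.le, ENNReal.toReal_ofNat,
    Real.rpow_ofNat, Real.norm_eq_abs] at h
  rw [← hD] at h
  have h' := Real.rpow_le_rpow (by positivity) h hq0.le
  rw [← Real.rpow_mul hI0, inv_mul_cancel₀ hq0.ne', Real.rpow_one,
    Real.mul_rpow (by positivity) (by positivity), ← Real.rpow_mul hD0] at h'
  have he : (2 : ℝ)⁻¹ * q = N / (N - 2) := by rw [hq]; field_simp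
  rw [he] at h'
  refine h'.trans ?_
  gcongr
  linarith

theorem contDiff_div_of_ne_zero_on_tsupport {E : Type*} [NormedAddCommGroup E] [NormedSpace ℝ E]
    {n : WithTop ℕ∞} {u g : E → ℝ} (hu : ContDiff ℝ n u) (hg : ContDiff ℝ n g)
    (h : ∀ x ∈ tsupport u, g x ≠ 0) : ContDiff ℝ n fun x ↦ u x / g x := by
  refine contDiff_iff_contDiffAt.2 fun x ↦ ?_
  by_cases hx : x ∈ tsupport u
  · exact hu.contDiffAt.div hg.contDiffAt (h x hx)
  · refine (contDiffAt_const (c := (0 : ℝ))).congr_of_eventuallyEq ?_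
    filter_upwards [notMem_tsupport_iff_eventuallyEq.1 hx] with y hy
    simp [hy]

open Module in
theorem exists_integral_rpow_mul_rpow_neg_le {E : Type*} [NormedAddCommGroup E]
    [InnerProductSpace ℝ E] [FiniteDimensional ℝ E] [MeasurableSpace E] [BorelSpace E]
    (μ : Measure E) [μ.IsAddHaarMeasure] (hE : 3 ≤ finrank ℝ E) :
    ∃ C : ℝ, 0 < C ∧ ∀ s ∈ Ioo (0 : ℝ) 2, ∀ (L : E →L[ℝ] ℝ) (e : E), L e = 1 → ‖e‖ ≤ 1 →
      ∀ u : E → ℝ, ContDiff ℝ 1 u → HasCompactSupport u → (∀ x ∈ tsupport u, 0 < L x) →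
      ∫ x, |u x| ^ (2 * ((finrank ℝ E : ℝ) - s) / (finrank ℝ E - 2)) * L x ^ (-s) ∂μ ≤
        C * (∫ x, ‖fderiv ℝ u x‖ ^ 2 ∂μ) ^
          (((finrank ℝ E : ℝ) - s) / (finrank ℝ E - 2)) := by
  obtain ⟨K, hK, hsob⟩ := exists_integral_rpow_le_of_sobolev μ hE
  set N : ℝ := (finrank ℝ E : ℝ) with hN
  have hN3 : 3 ≤ N := by rw [hN]; exact_mod_cast hE
  have hN2 : 0 < N - 2 := by linarith
  refine ⟨max 4 K, by positivity, fun s ⟨hs0, hs2⟩ L e he hen u hu huc hL ↦ ?_⟩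
  have hs2' : 0 < 2 - s := by linarith
  set C := max 4 K with hC
  have hC0 : 0 < C := by positivity
  set D := ∫ x, ‖fderiv ℝ u x‖ ^ 2 ∂μ with hD
  have hD0 : 0 ≤ D := integral_nonneg fun x ↦ by positivity
  set w : E → ℝ := fun x ↦ u x / L x with hw
  have hwd : ContDiff ℝ 1 w :=
    contDiff_div_of_ne_zero_on_tsupport hu L.contDiff fun x hx ↦ (hL x hx).ne'
  have hwc : HasCompactSupport w := huc.mono fun x hx h0 ↦ hx (by simp [hw, h0])
  have hux (x : E) : w x * L x = u x := by
    by_cases hx : x ∈ tsupport u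
    · exact div_mul_cancel₀ _ (hL x hx).ne'
    · simp [hw, image_eq_zero_of_notMem_tsupport hx]
  have hardy : ∫ x, w x ^ 2 ∂μ ≤ C * D := by
    refine (integral_sq_le_of_mul_linear L he hwd hwc).trans ?_
    simp only [hux]
    refine mul_le_mul (le_max_left _ _) ?_ (integral_nonneg fun x ↦ sq_nonneg _) hC0.le
    refine integral_mono_of_nonneg (.of_forall fun x ↦ sq_nonneg _)
      (MemLp.integrable_norm_pow (p := 2) ?_ two_ne_zero) (.of_forall fun x ↦ ?_)
    · exact (hu.continuous_fderiv one_ne_zero).memLp_of_hasCompactSupport (huc.fderiv ℝ)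
    · refine sq_le_sq.2 ?_
      rw [abs_norm, ← Real.norm_eq_abs]
      exact (ContinuousLinearMap.le_opNorm _ _).trans
        (mul_le_of_le_one_right (norm_nonneg _) hen)
  have hsobolev : ∫ x, |u x| ^ (2 * N / (N - 2)) ∂μ ≤ C * D ^ (N / (N - 2)) :=
    (hsob u hu huc).trans (by gcongr; exact le_max_right _ _)
  set b : ℝ := N * (2 - s) / (N - 2) with hb
  have hb0 : 0 < b := by positivity
  have hmem {v : E → ℝ} (hv : Continuous v) (hvc : HasCompactSupport v) {a : ℝ} (ha : 0 < a)
      (p : ENNReal) : MemLp (fun x ↦ |v x| ^ a) p μ :=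
    (hv.abs.rpow_const fun _ ↦ .inr ha.le).memLp_of_hasCompactSupport
      (hvc.comp_left (g := fun t : ℝ ↦ |t| ^ a) (by simp [ha.ne']))
  have hpq : (2 / s).HolderConjugate (2 / (2 - s)) := by
    rw [Real.holderConjugate_iff]
    refine ⟨by rw [one_lt_div hs0]; exact hs2, by field_simp; ring⟩
  have hholder := integral_mul_le_Lp_mul_Lq_of_nonneg (μ := μ) hpq
    (f := fun x ↦ |w x| ^ s) (g := fun x ↦ |u x| ^ b)
    (.of_forall fun x ↦ by positivity) (.of_forall fun x ↦ by positivity)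
    (hmem hwd.continuous hwc hs0 _) (hmem hu.continuous huc hb0 _)
  have hintegrand (x : E) :
      |u x| ^ (2 * (N - s) / (N - 2)) * L x ^ (-s) = |w x| ^ s * |u x| ^ b := by
    have hexp : 2 * (N - s) / (N - 2) = s + b := by rw [hb]; field_simp; ring
    by_cases hx : x ∈ tsupport u
    · have hLx := hL x hx
      rw [hexp, Real.rpow_add_of_nonneg (abs_nonneg _) hs0.le hb0.le, Real.rpow_neg hLx.le,
        hw, abs_div, abs_of_pos hLx, Real.div_rpow (abs_nonneg _) hLx.le]
      ring
    · rw [image_eq_zero_of_notMem_tsupport hx, hexp, abs_zero, Real.zero_rpow hb0.ne',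
        Real.zero_rpow (by positivity)]
      simp
  have hpow1 (x : E) : (|w x| ^ s) ^ (2 / s) = w x ^ 2 := by
    rw [← Real.rpow_mul (abs_nonneg _), mul_div_cancel₀ _ hs0.ne', Real.rpow_two, sq_abs]
  have hpow2 (x : E) : (|u x| ^ b) ^ (2 / (2 - s)) = |u x| ^ (2 * N / (N - 2)) := by
    rw [← Real.rpow_mul (abs_nonneg _)]
    congr 1
    rw [hb]; field_simp
  simp only [hpow1, hpow2, one_div_div] at hholder
  simp only [hintegrand]
  calc _ ≤ _ := hholder
    _ ≤ (C * D) ^ (s / 2) * (C * D ^ (N / (N - 2))) ^ ((2 - s) / 2) := by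
      gcongr
    _ = C * D ^ ((N - s) / (N - 2)) := by
      have hexp : (N - s) / (N - 2) = s / 2 + N / (N - 2) * ((2 - s) / 2) := by field_simp; ring
      rw [Real.mul_rpow hC0.le hD0, Real.mul_rpow hC0.le (by positivity), ← Real.rpow_mul hD0,
        hexp, Real.rpow_add_of_nonneg hD0 (by positivity) (by positivity), mul_mul_mul_comm,
        ← Real.rpow_add hC0]
      rw [show s / 2 + (2 - s) / 2 = 1 by ring, Real.rpow_one]

/-- Hardy–Sobolev inequality on half balls, `n ≥ 3` (Lemma 2.1 of the paper). -/
theorem stmt0 (n : ℕ) (hn : 3 ≤ n) :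
    ∃ C : ℝ, 0 < C ∧
      ∀ (s R : ℝ), s ∈ Set.Ioo (0 : ℝ) 2 → 1 ≤ R →
        ∀ u : EuclideanSpace ℝ (Fin n) → ℝ,
          ContDiff ℝ 1 u → HasCompactSupport u → tsupport u ⊆ halfBall n R →
          (∫ x in halfBall n R,
              |u x| ^ (2 * ((n : ℝ) - s) / ((n : ℝ) - 2)) * lastC x ^ (-s))
              ^ (((n : ℝ) - 2) / ((n : ℝ) - s))
            ≤ C ^ (((n : ℝ) - 2) / ((n : ℝ) - s)) *
                ∫ x in halfBall n R, ‖gradient u x‖ ^ 2 := by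
  have hn0 : 0 < n := by omega
  have hfin : Module.finrank ℝ (EuclideanSpace ℝ (Fin n)) = n := finrank_euclideanSpace_fin
  obtain ⟨C, hC, hmain⟩ := exists_integral_rpow_mul_rpow_neg_le
    (volume : Measure (EuclideanSpace ℝ (Fin n))) (by rw [hfin]; exact hn)
  rw [hfin] at hmain
  refine ⟨C, hC, fun s R hs _ u hu huc hsupp ↦ ?_⟩
  have hn3 : (3 : ℝ) ≤ n := by exact_mod_cast hn
  have hn2 : (0 : ℝ) < n - 2 := by linarith
  have hns : (0 : ℝ) < n - s := by linarith [hs.2]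
  let i : Fin n := ⟨n - 1, by omega⟩
  let L : EuclideanSpace ℝ (Fin n) →L[ℝ] ℝ := EuclideanSpace.proj i
  have hL (x : EuclideanSpace ℝ (Fin n)) : L x = lastC x := by simp [L, i, lastC, hn0]
  have h := hmain s hs L (EuclideanSpace.single i 1) (by simp [L]) (by simp) u hu huc
    fun x hx ↦ by rw [hL]; exact (hsupp hx).2
  simp only [hL] at h
  have hgrad (x : EuclideanSpace ℝ (Fin n)) : ‖gradient u x‖ = ‖fderiv ℝ u x‖ := by
    simp [gradient]
  simp only [hgrad]
  rw [setIntegral_eq_integral_of_forall_compl_eq_zero fun x hx ↦ by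
      have hexp : 2 * ((n : ℝ) - s) / (n - 2) ≠ 0 := by positivity
      simp [image_eq_zero_of_notMem_tsupport fun hx' ↦ hx (hsupp hx'), Real.zero_rpow hexp],
    setIntegral_eq_integral_of_forall_compl_eq_zero fun x hx ↦ by
      simp [fderiv_of_notMem_tsupport (𝕜 := ℝ) fun hx' ↦ hx (hsupp hx')]]
  have hD0 : 0 ≤ ∫ x, ‖fderiv ℝ u x‖ ^ 2 := integral_nonneg fun x ↦ by positivity
  have hI0 : 0 ≤ ∫ x, |u x| ^ (2 * ((n : ℝ) - s) / ((n : ℝ) - 2)) * lastC x ^ (-s) := by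
    refine integral_nonneg fun x ↦ ?_
    by_cases hx : x ∈ tsupport u
    · have := (hsupp hx).2
      positivity
    · have hexp : 2 * ((n : ℝ) - s) / (n - 2) ≠ 0 := by positivity
      simp [image_eq_zero_of_notMem_tsupport hx, Real.zero_rpow hexp]
  refine (Real.rpow_le_rpow hI0 h (by positivity)).trans_eq ?_
  rw [Real.mul_rpow hC.le (by positivity), ← Real.rpow_mul hD0,
    div_mul_div_cancel₀ hn2.ne', div_self hns.ne', Real.rpow_one]
end
end

section
/- Let n ∈ {1,2}. For every R ≥ 1, every s ∈ (0,2) and every r ∈ [s, ∞) there exists a constant C > 0 depending only on R, r, s (and n) such that for every continuously differentiable function u : ℝ^n → ℝ whose support is a compact subset of the open half-ball B_R^+, one has (∫_{B_R^+} |u(x)|^{r} x_n^{−s} dx)^{2/r} ≤ C ∫_{B_R^+} |∇u(x)|² dx. -/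
open MeasureTheory Real Set

noncomputable section

lemma continuous_lastC {n : ℕ} : Continuous (lastC : EuclideanSpace ℝ (Fin n) → ℝ) := by
  unfold lastC
  split_ifs <;> fun_prop

lemma measurableSet_halfBall (n : ℕ) (R : ℝ) : MeasurableSet (halfBall n R) :=
  ((isOpen_lt continuous_norm continuous_const).inter
    (isOpen_lt continuous_const continuous_lastC)).measurableSet

lemma lastC_le_norm {n : ℕ} (x : EuclideanSpace ℝ (Fin n)) : lastC x ≤ ‖x‖ := by
  unfold lastC
  split_ifs
  · exact (le_abs_self _).trans (PiLp.norm_apply_le x _)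
  · exact norm_nonneg x

lemma sq_le_mul_integral_deriv_sq {f : ℝ → ℝ} (hf : ContDiff ℝ 1 f) (h0 : f 0 = 0) {y : ℝ}
    (hy : 0 < y) : f y ^ 2 ≤ y * ∫ t in (0 : ℝ)..y, deriv f t ^ 2 := by
  have hc : Continuous (deriv f) := hf.continuous_deriv le_rfl
  have h1 : ∫ t in (0 : ℝ)..y, deriv f t = f y := by
    rw [intervalIntegral.integral_deriv_eq_sub
      (fun x _ => (hf.differentiable one_ne_zero).differentiableAt)
      (hc.intervalIntegrable _ _), h0, sub_zero]
  have h2 : 0 ≤ ∫ t in (0 : ℝ)..y, (deriv f t - f y / y) ^ 2 :=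
    intervalIntegral.integral_nonneg hy.le fun t _ => sq_nonneg _
  have h3 : ∫ t in (0 : ℝ)..y, (deriv f t - f y / y) ^ 2 =
      (∫ t in (0 : ℝ)..y, deriv f t ^ 2) - f y ^ 2 / y := by
    have : ∀ t, (deriv f t - f y / y) ^ 2 =
        deriv f t ^ 2 - (2 * (f y / y)) * deriv f t + (f y / y) ^ 2 := fun t => by ring
    simp_rw [this]
    rw [intervalIntegral.integral_add, intervalIntegral.integral_sub,
      intervalIntegral.integral_const_mul, h1, intervalIntegral.integral_const, sub_zero,
      smul_eq_mul]
    · field_simp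
      ring
    all_goals exact Continuous.intervalIntegrable (by fun_prop) _ _
  rw [h3, sub_nonneg, div_le_iff₀ hy] at h2
  linarith

lemma ofReal_sq_le_mul_lintegral_deriv_sq {f : ℝ → ℝ} (hf : ContDiff ℝ 1 f) (h0 : f 0 = 0)
    {y : ℝ} (hy : 0 < y) :
    ENNReal.ofReal (f y ^ 2) ≤ ENNReal.ofReal y * ∫⁻ t, ENNReal.ofReal (deriv f t ^ 2) := by
  have hc : Continuous (deriv f) := hf.continuous_deriv le_rfl
  refine (ENNReal.ofReal_le_ofReal (sq_le_mul_integral_deriv_sq hf h0 hy)).trans ?_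
  rw [ENNReal.ofReal_mul hy.le, intervalIntegral.integral_of_le hy.le,
    ofReal_integral_eq_lintegral_ofReal]
  · gcongr
    exact Measure.restrict_le_self
  · exact (Continuous.integrableOn_Ioc (by fun_prop))
  · exact Filter.Eventually.of_forall fun t => sq_nonneg _

/-- A function vanishing at the base point `a` of a line grows along it at most like the square
root of the distance times the Dirichlet energy on the line. -/
lemma ofReal_sq_le_mul_lintegral_line {E : Type*} [NormedAddCommGroup E] [NormedSpace ℝ E]
    {u : E → ℝ} (hu : ContDiff ℝ 1 u) {a e : E} (he : ‖e‖ ≤ 1) (h0 : u a = 0) {y : ℝ}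
    (hy : 0 < y) :
    ENNReal.ofReal (u (a + y • e) ^ 2) ≤
      ENNReal.ofReal y * ∫⁻ t : ℝ, ENNReal.ofReal (‖fderiv ℝ u (a + t • e)‖ ^ 2) := by
  have hf : ContDiff ℝ 1 fun t : ℝ => u (a + t • e) := by fun_prop
  refine (ofReal_sq_le_mul_lintegral_deriv_sq hf (by simpa using h0) hy).trans ?_
  refine mul_le_mul' le_rfl (lintegral_mono fun t => ENNReal.ofReal_le_ofReal ?_)
  have hd : HasDerivAt (fun t : ℝ => u (a + t • e)) (fderiv ℝ u (a + t • e) e) t := by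
    refine (hu.differentiable one_ne_zero _).hasFDerivAt.comp_hasDerivAt t ?_
    simpa using ((hasDerivAt_id t).smul_const e).const_add a
  rw [hd.deriv, ← sq_abs]
  refine pow_le_pow_left₀ (abs_nonneg _) ?_ 2
  exact ((fderiv ℝ u (a + t • e)).le_opNorm e).trans
    (mul_le_of_le_one_right (norm_nonneg _) he)

lemma lintegral_euclideanSpace_one (f : EuclideanSpace ℝ (Fin 1) → ENNReal) :
    ∫⁻ z, f z = ∫⁻ y : ℝ, f !₂[y] := by
  have h1 := (PiLp.volume_preserving_toLp (Fin 1)).lintegral_comp_emb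
    (MeasurableEquiv.toLp 2 (Fin 1 → ℝ)).measurableEmbedding f
  have h2 := ((volume_preserving_funUnique (Fin 1) ℝ).symm _).lintegral_comp_emb
    (MeasurableEquiv.funUnique (Fin 1) ℝ).symm.measurableEmbedding
    (fun v => f (WithLp.toLp 2 v))
  refine h1.symm.trans (h2.symm.trans (lintegral_congr fun y => congrArg f ?_))
  ext i
  fin_cases i
  rfl

lemma lintegral_euclideanSpace_two {f : EuclideanSpace ℝ (Fin 2) → ENNReal} (hf : Measurable f) :
    ∫⁻ z, f z = ∫⁻ x : ℝ, ∫⁻ y : ℝ, f !₂[x, y] := by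
  have h1 := (PiLp.volume_preserving_toLp (Fin 2)).lintegral_comp_emb
    (MeasurableEquiv.toLp 2 (Fin 2 → ℝ)).measurableEmbedding f
  have h2 := ((volume_preserving_finTwoArrow ℝ).symm _).lintegral_comp_emb
    (MeasurableEquiv.finTwoArrow (α := ℝ)).symm.measurableEmbedding
    (fun v => f (WithLp.toLp 2 v))
  rw [← h1, ← h2, Measure.volume_eq_prod, lintegral_prod]
  · refine lintegral_congr fun x => lintegral_congr fun y => congrArg f ?_
    ext i
    fin_cases i <;> rfl
  · exact (hf.comp ((MeasurableEquiv.toLp 2 (Fin 2 → ℝ)).measurable.comp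
      (MeasurableEquiv.finTwoArrow (α := ℝ)).symm.measurable)).aemeasurable

lemma lintegral_Ioo_rpow_lt_top {R c : ℝ} (hR : 0 < R) (hc : -1 < c) :
    ∫⁻ y in Ioo 0 R, ENNReal.ofReal (y ^ c) < ⊤ := by
  have := (intervalIntegral.intervalIntegrable_rpow' (a := 0) (b := R) hc)
  rw [intervalIntegrable_iff_integrableOn_Ioo_of_le hR.le] at this
  exact this.lintegral_lt_top

lemma setLIntegral_halfBall_one_le {R : ℝ} (f : EuclideanSpace ℝ (Fin 1) → ENNReal) :
    ∫⁻ z in halfBall 1 R, f z ≤ ∫⁻ y in Ioo 0 R, f !₂[y] := by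
  rw [← lintegral_indicator (measurableSet_halfBall 1 R), lintegral_euclideanSpace_one,
    ← lintegral_indicator measurableSet_Ioo]
  refine lintegral_mono fun y => ?_
  by_cases h : (!₂[y] : EuclideanSpace ℝ (Fin 1)) ∈ halfBall 1 R
  · have hy : y ∈ Ioo 0 R := ⟨h.2, (lastC_le_norm !₂[y]).trans_lt h.1⟩
    simp only [indicator_of_mem h, indicator_of_mem hy, le_refl]
  · simp only [indicator_of_notMem h, zero_le]

lemma setLIntegral_halfBall_two_le {R : ℝ} {f : EuclideanSpace ℝ (Fin 2) → ENNReal}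
    (hf : Measurable f) :
    ∫⁻ z in halfBall 2 R, f z ≤ ∫⁻ x in Ioo (-R) R, ∫⁻ y in Ioo 0 R, f !₂[x, y] := by
  rw [← lintegral_indicator (measurableSet_halfBall 2 R),
    lintegral_euclideanSpace_two (hf.indicator (measurableSet_halfBall 2 R)),
    ← lintegral_indicator measurableSet_Ioo]
  refine lintegral_mono fun x => ?_
  by_cases hx : x ∈ Ioo (-R) R
  · rw [indicator_of_mem hx, ← lintegral_indicator measurableSet_Ioo]
    refine lintegral_mono fun y => ?_
    by_cases h : !₂[x, y] ∈ halfBall 2 R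
    · have hy : y ∈ Ioo 0 R := ⟨h.2, (lastC_le_norm !₂[x, y]).trans_lt h.1⟩
      simp only [indicator_of_mem h, indicator_of_mem hy, le_refl]
    · simp only [indicator_of_notMem h, zero_le]
  · have h (y : ℝ) : !₂[x, y] ∉ halfBall 2 R := fun h =>
      hx (abs_lt.1 ((PiLp.norm_apply_le !₂[x, y] 0).trans_lt h.1))
    simp only [indicator_of_notMem (h _), lintegral_zero, zero_le]

lemma norm_gradient_eq_norm_fderiv {n : ℕ} (u : EuclideanSpace ℝ (Fin n) → ℝ)
    (z : EuclideanSpace ℝ (Fin n)) :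
    ‖gradient u z‖ = ‖fderiv ℝ u z‖ := by
  simp [gradient]

/-- The test functions: continuously differentiable, compactly supported in the half ball. -/
structure IsTest (n : ℕ) (R : ℝ) (u : EuclideanSpace ℝ (Fin n) → ℝ) : Prop where
  contDiff : ContDiff ℝ 1 u
  hasCompactSupport : HasCompactSupport u
  subset : tsupport u ⊆ halfBall n R

namespace IsTest

variable {n : ℕ} {R : ℝ} {u : EuclideanSpace ℝ (Fin n) → ℝ}

lemma eq_zero (hu : IsTest n R u) {z : EuclideanSpace ℝ (Fin n)} (hz : lastC z = 0) :
    u z = 0 :=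
  image_eq_zero_of_notMem_tsupport fun h => (hu.subset h).2.ne' hz

lemma const_smul (hu : IsTest n R u) (c : ℝ) : IsTest n R (c • u) where
  contDiff := hu.contDiff.const_smul c
  hasCompactSupport := hu.hasCompactSupport.smul_left
  subset := (closure_mono (Function.support_const_smul_subset c u)).trans hu.subset

lemma lintegral_fderiv_sq (hu : IsTest n R u) :
    ∫⁻ z, ENNReal.ofReal (‖fderiv ℝ u z‖ ^ 2) =
      ENNReal.ofReal (∫ z in halfBall n R, ‖gradient u z‖ ^ 2) := by
  simp_rw [norm_gradient_eq_norm_fderiv]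
  have hc : Continuous (fderiv ℝ u) := hu.contDiff.continuous_fderiv one_ne_zero
  have hs : Function.support (fun z => ‖fderiv ℝ u z‖ ^ 2) ⊆ halfBall n R := by
    intro z hz
    refine hu.subset (support_fderiv_subset ℝ (f := u) ?_)
    simpa using hz
  rw [setIntegral_eq_integral_of_forall_compl_eq_zero
    (fun z hz => Function.notMem_support.1 fun h => hz (hs h)),
    ofReal_integral_eq_lintegral_ofReal]
  · refine Continuous.integrable_of_hasCompactSupport (by fun_prop) ?_
    exact (hu.hasCompactSupport.fderiv ℝ).comp_left (g := fun L => ‖L‖ ^ 2) (by simp)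
  · exact Filter.Eventually.of_forall fun z => sq_nonneg _

end IsTest

lemma exists_lintegral_sq_mul_rpow_le_two {R b : ℝ} (hR : 0 < R) (hb : b < 2) :
    ∃ K : ENNReal, K < ⊤ ∧ ∀ u, IsTest 2 R u →
      ∫⁻ z in halfBall 2 R, ENNReal.ofReal (u z ^ 2 * lastC z ^ (-b)) ≤
        K * ∫⁻ z, ENNReal.ofReal (‖fderiv ℝ u z‖ ^ 2) := by
  refine ⟨∫⁻ y in Ioo 0 R, ENNReal.ofReal (y ^ (1 - b)),
    lintegral_Ioo_rpow_lt_top hR (by linarith), fun u hu => ?_⟩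
  have hm : Measurable (lastC : EuclideanSpace ℝ (Fin 2) → ℝ) := continuous_lastC.measurable
  have hum : Measurable u := hu.contDiff.continuous.measurable
  have hdm : Measurable (fderiv ℝ u) :=
    (hu.contDiff.continuous_fderiv one_ne_zero).measurable
  set K := ∫⁻ y in Ioo 0 R, ENNReal.ofReal (y ^ (1 - b))
  rw [lintegral_euclideanSpace_two (by fun_prop), ← lintegral_const_mul']
  swap
  · exact (lintegral_Ioo_rpow_lt_top hR (by linarith)).ne
  refine (setLIntegral_halfBall_two_le (by fun_prop)).trans ?_
  refine (setLIntegral_le_lintegral _ _).trans (lintegral_mono fun x => ?_)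
  set G := ∫⁻ y : ℝ, ENNReal.ofReal (‖fderiv ℝ u !₂[x, y]‖ ^ 2) with hG
  rw [mul_comm, ← lintegral_const_mul _ (by fun_prop)]
  refine setLIntegral_mono' measurableSet_Ioo fun y hy => ?_
  have hline (t : ℝ) : !₂[x, t] = !₂[x, 0] + t • !₂[(0 : ℝ), 1] := by
    ext i
    fin_cases i <;> simp
  have key := ofReal_sq_le_mul_lintegral_line hu.contDiff (a := !₂[x, 0]) (e := !₂[(0 : ℝ), 1])
    (by simp [EuclideanSpace.norm_eq]) (hu.eq_zero rfl) hy.1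
  simp_rw [← hline, ← hG] at key
  have hl : lastC !₂[x, y] = y := rfl
  have hp : y ^ (1 - b) = y * y ^ (-b) := by
    rw [sub_eq_add_neg, Real.rpow_add hy.1, Real.rpow_one]
  rw [hl, hp, ENNReal.ofReal_mul (sq_nonneg _), ENNReal.ofReal_mul hy.1.le, ← mul_assoc,
    mul_comm G]
  gcongr

lemma lintegral_lastC_rpow_lt_top_two {R c : ℝ} (hR : 0 < R) (hc : -1 < c) :
    ∫⁻ z in halfBall 2 R, ENNReal.ofReal (lastC z ^ c) < ⊤ := by
  have hm : Measurable (lastC : EuclideanSpace ℝ (Fin 2) → ℝ) := continuous_lastC.measurable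
  refine (setLIntegral_halfBall_two_le (by fun_prop)).trans_lt ?_
  have : ∀ x y : ℝ, lastC !₂[x, y] = y := fun _ _ => rfl
  simp_rw [this, lintegral_const]
  exact ENNReal.mul_lt_top (lintegral_Ioo_rpow_lt_top hR hc) (by simp)

lemma exists_lintegral_abs_rpow_le_two {R q : ℝ} (hq : 2 ≤ q) :
    ∃ K : ENNReal, K < ⊤ ∧ ∀ u, IsTest 2 R u →
      ∫⁻ z, ENNReal.ofReal (‖fderiv ℝ u z‖ ^ 2) ≤ 1 →
        ∫⁻ z, ENNReal.ofReal (|u z| ^ q) ≤ K := by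
  have hq0 : 0 < q := by linarith
  set B : Set (EuclideanSpace ℝ (Fin 2)) := Metric.ball 0 R
  set p : NNReal := (2 * q / (q + 2)).toNNReal
  have hpc : (p : ℝ) = 2 * q / (q + 2) := Real.coe_toNNReal _ (by positivity)
  have hp1 : 1 ≤ p := by
    rw [← NNReal.coe_le_coe, hpc, NNReal.coe_one, le_div_iff₀ (by positivity)]
    linarith
  have hp2 : p < 2 := by
    rw [← NNReal.coe_lt_coe, hpc, NNReal.coe_ofNat, div_lt_iff₀ (by positivity)]
    linarith
  have hpq : (p : ℝ)⁻¹ - (Module.finrank ℝ (EuclideanSpace ℝ (Fin 2)) : ℝ)⁻¹ ≤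
      (q.toNNReal : ℝ)⁻¹ := by
    rw [hpc, Real.coe_toNNReal _ hq0.le, finrank_euclideanSpace, Fintype.card_fin]
    apply le_of_eq
    field_simp
    push_cast
    ring
  set M : ENNReal := volume B ^ (1 / (p : ENNReal).toReal - 1 / (2 : ENNReal).toReal) with hM
  set C : ENNReal := ENNReal.ofNNReal (eLpNormLESNormFDerivOfLeConst ℝ volume B p q.toNNReal)
  have hMtop : M < ⊤ := by
    refine ENNReal.rpow_lt_top_of_nonneg ?_ measure_ball_lt_top.ne
    rw [sub_nonneg]
    have : (p : ℝ) ≤ 2 := by exact_mod_cast hp2.le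
    have h0 : (0 : ℝ) < p := by exact_mod_cast zero_lt_one.trans_le hp1
    simpa using inv_anti₀ h0 this
  refine ⟨(C * M) ^ q, ENNReal.rpow_lt_top_of_nonneg hq0.le
    (ENNReal.mul_lt_top ENNReal.coe_lt_top hMtop).ne, fun u hu h1 => ?_⟩
  have hball : halfBall 2 R ⊆ B := fun z hz => by simpa [B] using hz.1
  have hcd := hu.contDiff.continuous_fderiv one_ne_zero
  have hS := eLpNorm_le_eLpNorm_fderiv_of_le (volume : Measure (EuclideanSpace ℝ (Fin 2)))
    hu.contDiff (((subset_tsupport u).trans hu.subset).trans hball) hp1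
    (by simpa using hp2) hpq Metric.isBounded_ball
  have h2 : eLpNorm (fderiv ℝ u) 2 volume ≤ 1 := by
    rw [eLpNorm_eq_lintegral_rpow_enorm_toReal two_ne_zero ENNReal.ofNat_ne_top]
    refine ENNReal.rpow_le_one (le_trans (le_of_eq (lintegral_congr fun z => ?_)) h1)
      (by positivity)
    rw [← ofReal_norm, ENNReal.ofReal_rpow_of_nonneg (norm_nonneg _) (by simp)]
    simp
  have h3 : eLpNorm (fderiv ℝ u) p volume ≤ M := by
    have hsup : Function.support (fderiv ℝ u) ⊆ B :=
      ((support_fderiv_subset ℝ).trans hu.subset).trans hball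
    rw [← eLpNorm_restrict_eq_of_support_subset (f := fderiv ℝ u) hsup]
    refine (eLpNorm_le_eLpNorm_mul_rpow_measure_univ (q := 2) (by exact_mod_cast hp2.le)
      hcd.aestronglyMeasurable).trans ?_
    rw [Measure.restrict_apply_univ, ← hM]
    exact mul_le_of_le_one_left' ((eLpNorm_restrict_le _ _ _ _).trans h2)
  have h4 : eLpNorm u q.toNNReal volume ≤ C * M := hS.trans (by gcongr)
  rw [eLpNorm_eq_lintegral_rpow_enorm_toReal (by simpa using hq0) ENNReal.coe_ne_top,
    ENNReal.coe_toReal, Real.coe_toNNReal _ hq0.le, one_div, ENNReal.rpow_inv_le_iff hq0] at h4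
  refine le_trans (le_of_eq (lintegral_congr fun z => ?_)) h4
  rw [← ofReal_norm, ENNReal.ofReal_rpow_of_nonneg (norm_nonneg _) hq0.le,
    Real.norm_eq_abs]

lemma rpow_mul_rpow_le_add {x y w : ℝ} (hx : 0 ≤ x) (hy : 0 ≤ y) (hw0 : 0 ≤ w) (hw1 : w ≤ 1) :
    x ^ w * y ^ (1 - w) ≤ x + y := by
  have := Real.geom_mean_le_arith_mean2_weighted hw0 (sub_nonneg.2 hw1) hx hy (by ring)
  nlinarith

lemma rpow_mul_rpow_neg_le_of_le_two {a y r s : ℝ} (ha : 0 ≤ a) (hy : 0 < y) (hr : 0 < r)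
    (hr2 : r ≤ 2) :
    a ^ r * y ^ (-s) ≤ a ^ 2 * y ^ (-(1 + s - r / 2)) + y ^ (r / 2 - s) := by
  have h := rpow_mul_rpow_le_add (x := a ^ 2 * y ^ (-(1 + s - r / 2))) (y := y ^ (r / 2 - s))
    (w := r / 2) (by positivity) (by positivity) (by positivity) (by linarith)
  refine le_trans (le_of_eq ?_) h
  rw [← Real.rpow_natCast a 2, Real.mul_rpow (by positivity) (by positivity),
    ← Real.rpow_mul ha, ← Real.rpow_mul hy.le, ← Real.rpow_mul hy.le, mul_assoc,
    ← Real.rpow_add hy]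
  congr 2
  · push_cast
    ring
  · ring

lemma rpow_mul_rpow_neg_le_of_lt {a y r s b : ℝ} (ha : 0 ≤ a) (hy : 0 < y) (hs : 0 < s)
    (hsb : s < b) (hr2 : 2 < r) :
    a ^ r * y ^ (-s) ≤ a ^ 2 * y ^ (-b) + a ^ ((r - 2 * (s / b)) / (1 - s / b)) := by
  have hb : 0 < b := hs.trans hsb
  have hw : s / b < 1 := (div_lt_one hb).2 hsb
  have h := rpow_mul_rpow_le_add (x := a ^ 2 * y ^ (-b))
    (y := a ^ ((r - 2 * (s / b)) / (1 - s / b)))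
    (w := s / b) (by positivity) (by positivity) (by positivity) hw.le
  refine le_trans (le_of_eq ?_) h
  rcases ha.eq_or_lt with rfl | ha
  · rw [Real.zero_rpow (by linarith), Real.zero_rpow (div_pos (by linarith) (by linarith)).ne',
      Real.zero_rpow (by linarith)]
    ring
  rw [← Real.rpow_natCast a 2, Real.mul_rpow (by positivity) (by positivity),
    ← Real.rpow_mul ha.le, ← Real.rpow_mul hy.le, ← Real.rpow_mul ha.le, mul_right_comm,
    ← Real.rpow_add ha, div_mul_cancel₀ _ (by linarith)]
  congr 2
  · push_cast
    ring
  · field_simp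

lemma exists_lintegral_le_one {R s r : ℝ} (hR : 0 < R) (hs : s ∈ Ioo (0 : ℝ) 2) (hr : s ≤ r) :
    ∃ K : ENNReal, K < ⊤ ∧ ∀ u, IsTest 1 R u →
      ∫⁻ z, ENNReal.ofReal (‖fderiv ℝ u z‖ ^ 2) ≤ 1 →
        ∫⁻ z in halfBall 1 R, ENNReal.ofReal (|u z| ^ r * lastC z ^ (-s)) ≤ K := by
  obtain ⟨hs0, hs2⟩ := hs
  refine ⟨∫⁻ y in Ioo 0 R, ENNReal.ofReal (y ^ (r / 2 - s)),
    lintegral_Ioo_rpow_lt_top hR (by linarith), fun u hu h1 => ?_⟩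
  refine (setLIntegral_halfBall_one_le _).trans ?_
  refine setLIntegral_mono' measurableSet_Ioo fun y hy => ENNReal.ofReal_le_ofReal ?_
  have hline (t : ℝ) : (!₂[t] : EuclideanSpace ℝ (Fin 1)) =
      (!₂[0] : EuclideanSpace ℝ (Fin 1)) + t • (!₂[1] : EuclideanSpace ℝ (Fin 1)) := by
    ext i
    fin_cases i
    simp
  have key := ofReal_sq_le_mul_lintegral_line hu.contDiff (a := !₂[(0 : ℝ)]) (e := !₂[(1 : ℝ)])
    (by simp [EuclideanSpace.norm_eq]) (hu.eq_zero rfl) hy.1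
  simp_rw [← hline] at key
  rw [← lintegral_euclideanSpace_one (fun z => ENNReal.ofReal (‖fderiv ℝ u z‖ ^ 2))] at key
  have h2 : u (!₂[y]) ^ 2 ≤ y :=
    (ENNReal.ofReal_le_ofReal_iff hy.1.le).1 (key.trans (mul_le_of_le_one_right' h1))
  have hl : lastC (!₂[y] : EuclideanSpace ℝ (Fin 1)) = y := rfl
  rw [hl, sub_eq_add_neg, Real.rpow_add hy.1]
  refine mul_le_mul_of_nonneg_right ?_ (Real.rpow_nonneg hy.1.le _)
  calc |u (!₂[y])| ^ r = (u (!₂[y]) ^ 2) ^ (r / 2) := by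
        rw [← sq_abs, ← Real.rpow_natCast, ← Real.rpow_mul (abs_nonneg _)]
        congr 1
        push_cast
        ring
    _ ≤ y ^ (r / 2) := Real.rpow_le_rpow (sq_nonneg _) h2 (by linarith)

lemma exists_lintegral_le_two {R s r : ℝ} (hR : 0 < R) (hs : s ∈ Ioo (0 : ℝ) 2) (hr : s ≤ r) :
    ∃ K : ENNReal, K < ⊤ ∧ ∀ u, IsTest 2 R u →
      ∫⁻ z, ENNReal.ofReal (‖fderiv ℝ u z‖ ^ 2) ≤ 1 →
        ∫⁻ z in halfBall 2 R, ENNReal.ofReal (|u z| ^ r * lastC z ^ (-s)) ≤ K := by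
  obtain ⟨hs0, hs2⟩ := hs
  have hm : Measurable (lastC : EuclideanSpace ℝ (Fin 2) → ℝ) := continuous_lastC.measurable
  rcases le_or_gt r 2 with hr2 | hr2
  · obtain ⟨K, hK, H⟩ := exists_lintegral_sq_mul_rpow_le_two (b := 1 + s - r / 2) hR (by linarith)
    refine ⟨K + ∫⁻ z in halfBall 2 R, ENNReal.ofReal (lastC z ^ (r / 2 - s)),
      ENNReal.add_lt_top.2 ⟨hK, lintegral_lastC_rpow_lt_top_two hR (by linarith)⟩,
      fun u hu h1 => ?_⟩
    refine le_trans ?_ (add_le_add_left ((H u hu).trans (mul_le_of_le_one_right' h1)) _)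
    rw [← lintegral_add_right _ (by fun_prop)]
    refine setLIntegral_mono' (measurableSet_halfBall 2 R) fun z hz => ?_
    rw [← ENNReal.ofReal_add (mul_nonneg (sq_nonneg _) (Real.rpow_nonneg hz.2.le _))
      (Real.rpow_nonneg hz.2.le _), ← sq_abs (u z)]
    exact ENNReal.ofReal_le_ofReal
      (rpow_mul_rpow_neg_le_of_le_two (abs_nonneg _) hz.2 (hs0.trans_le hr) hr2)
  · set b := (s + 2) / 2 with hb
    have hsb : s < b := by linarith
    have hw : s / b < 1 := (div_lt_one (hs0.trans hsb)).2 hsb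
    set q := (r - 2 * (s / b)) / (1 - s / b) with hq
    have hq2 : 2 ≤ q := by
      rw [hq, le_div_iff₀ (by linarith)]
      linarith
    obtain ⟨K, hK, H⟩ := exists_lintegral_sq_mul_rpow_le_two (b := b) hR (by linarith)
    obtain ⟨L, hL, H'⟩ := exists_lintegral_abs_rpow_le_two (R := R) hq2
    refine ⟨K + L, ENNReal.add_lt_top.2 ⟨hK, hL⟩, fun u hu h1 => ?_⟩
    have hum : Measurable u := hu.contDiff.continuous.measurable
    refine le_trans ?_ (add_le_add ((H u hu).trans (mul_le_of_le_one_right' h1))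
      ((setLIntegral_le_lintegral (halfBall 2 R) _).trans (H' u hu h1)))
    rw [← lintegral_add_right _ (by fun_prop)]
    refine setLIntegral_mono' (measurableSet_halfBall 2 R) fun z hz => ?_
    rw [← ENNReal.ofReal_add (mul_nonneg (sq_nonneg _) (Real.rpow_nonneg hz.2.le _))
      (by positivity), ← sq_abs (u z)]
    exact ENNReal.ofReal_le_ofReal
      (rpow_mul_rpow_neg_le_of_lt (abs_nonneg _) hz.2 hs0 hsb hr2)

lemma setIntegral_nonneg_halfBall {n : ℕ} (R r s : ℝ) (u : EuclideanSpace ℝ (Fin n) → ℝ) :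
    0 ≤ ∫ z in halfBall n R, |u z| ^ r * lastC z ^ (-s) :=
  setIntegral_nonneg (measurableSet_halfBall n R) fun _ hz =>
    mul_nonneg (Real.rpow_nonneg (abs_nonneg _) _) (Real.rpow_nonneg hz.2.le _)

lemma setIntegral_le_toReal_of_lintegral_le {n : ℕ} {R s r : ℝ} {K : ENNReal} (hK : K < ⊤)
    {u : EuclideanSpace ℝ (Fin n) → ℝ} (hu : IsTest n R u)
    (h : ∫⁻ z in halfBall n R, ENNReal.ofReal (|u z| ^ r * lastC z ^ (-s)) ≤ K) :
    ∫ z in halfBall n R, |u z| ^ r * lastC z ^ (-s) ≤ K.toReal := by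
  have hm : Measurable (lastC : EuclideanSpace ℝ (Fin n) → ℝ) := continuous_lastC.measurable
  have hum : Measurable u := hu.contDiff.continuous.measurable
  rw [integral_eq_lintegral_of_nonneg_ae _ (by fun_prop)]
  · exact ENNReal.toReal_mono hK.ne h
  · refine (ae_restrict_iff' (measurableSet_halfBall n R)).2 (Filter.Eventually.of_forall ?_)
    exact fun z hz => mul_nonneg (Real.rpow_nonneg (abs_nonneg _) _) (Real.rpow_nonneg hz.2.le _)

/-- By homogeneity, it suffices to bound the left-hand side for test functions of Dirichlet energy
at most one. -/
lemma rpow_setIntegral_le_of_bound {n : ℕ} {R s r K : ℝ} (hr : 0 < r)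
    (H : ∀ u, IsTest n R u → ∫ z in halfBall n R, ‖gradient u z‖ ^ 2 ≤ 1 →
      ∫ z in halfBall n R, |u z| ^ r * lastC z ^ (-s) ≤ K)
    {u : EuclideanSpace ℝ (Fin n) → ℝ} (hu : IsTest n R u) :
    (∫ z in halfBall n R, |u z| ^ r * lastC z ^ (-s)) ^ (2 / r) ≤
      K ^ (2 / r) * ∫ z in halfBall n R, ‖gradient u z‖ ^ 2 := by
  set I := ∫ z in halfBall n R, |u z| ^ r * lastC z ^ (-s)
  set D := ∫ z in halfBall n R, ‖gradient u z‖ ^ 2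
  have hI : 0 ≤ I := setIntegral_nonneg_halfBall R r s u
  have hD : 0 ≤ D := integral_nonneg fun z => sq_nonneg _
  have scaled (c : ℝ) (hc : 0 ≤ c) (hcD : c ^ 2 * D ≤ 1) : c ^ r * I ≤ K := by
    have h1 : ∫ z in halfBall n R, ‖gradient (c • u) z‖ ^ 2 = c ^ 2 * D := by
      rw [← integral_const_mul]
      refine integral_congr_ae (Filter.Eventually.of_forall fun z => ?_)
      simp only [norm_gradient_eq_norm_fderiv]
      rw [fderiv_const_smul (hu.contDiff.differentiable one_ne_zero z), norm_smul, mul_pow,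
        Real.norm_eq_abs, sq_abs]
    have h2 : ∫ z in halfBall n R, |(c • u) z| ^ r * lastC z ^ (-s) = c ^ r * I := by
      rw [← integral_const_mul]
      refine integral_congr_ae (Filter.Eventually.of_forall fun z => ?_)
      simp only [Pi.smul_apply, smul_eq_mul, abs_mul, abs_of_nonneg hc]
      rw [Real.mul_rpow hc (abs_nonneg _), mul_assoc]
    rw [← h2]
    exact H _ (hu.const_smul c) (h1.trans_le hcD)
  rcases hD.eq_or_lt with h0 | h0
  · have hI0 : I = 0 := by
      by_contra hne
      have hIpos : 0 < I := lt_of_le_of_ne hI (Ne.symm hne)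
      have hK : 0 ≤ K := by
        have := scaled 0 le_rfl (by simp)
        rwa [Real.zero_rpow hr.ne', zero_mul] at this
      have := scaled (((K + 1) / I) ^ r⁻¹) (by positivity) (by rw [← h0]; simp)
      rw [Real.rpow_inv_rpow (by positivity) hr.ne', div_mul_cancel₀ _ hne] at this
      linarith
    rw [hI0, ← h0, Real.zero_rpow (by positivity), mul_zero]
  · have h := scaled (D ^ (-(1 / 2) : ℝ)) (by positivity) (by
      rw [← Real.rpow_natCast, ← Real.rpow_mul hD]
      norm_num
      rw [Real.rpow_neg_one, inv_mul_cancel₀ h0.ne'])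
    have h' := Real.rpow_le_rpow (by positivity) h (z := 2 / r) (by positivity)
    rw [Real.mul_rpow (by positivity) hI, ← Real.rpow_mul hD, ← Real.rpow_mul hD,
      show -(1 / 2) * r * (2 / r) = (-1 : ℝ) by field_simp, Real.rpow_neg_one] at h'
    rwa [inv_mul_le_iff₀ h0, mul_comm] at h'

/-- Hardy–Sobolev inequality on half balls, dimensions `n = 1, 2`
(Lemma 2.1 of the paper). -/
theorem stmt1 (n : ℕ) (hn : n = 1 ∨ n = 2) :
    ∀ (R s r : ℝ), 1 ≤ R → s ∈ Set.Ioo (0 : ℝ) 2 → s ≤ r →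
      ∃ C : ℝ, 0 < C ∧
        ∀ u : EuclideanSpace ℝ (Fin n) → ℝ,
          ContDiff ℝ 1 u → HasCompactSupport u → tsupport u ⊆ halfBall n R →
          (∫ x in halfBall n R, |u x| ^ r * lastC x ^ (-s)) ^ (2 / r)
            ≤ C * ∫ x in halfBall n R, ‖gradient u x‖ ^ 2 := by
  intro R s r hR hs hr
  have hR0 : 0 < R := zero_lt_one.trans_le hR
  have hr0 : 0 < r := hs.1.trans_le hr
  obtain ⟨K, hK, H⟩ : ∃ K : ENNReal, K < ⊤ ∧ ∀ u, IsTest n R u →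
      ∫⁻ z, ENNReal.ofReal (‖fderiv ℝ u z‖ ^ 2) ≤ 1 →
        ∫⁻ z in halfBall n R, ENNReal.ofReal (|u z| ^ r * lastC z ^ (-s)) ≤ K := by
    rcases hn with rfl | rfl
    · exact exists_lintegral_le_one hR0 hs hr
    · exact exists_lintegral_le_two hR0 hs hr
  refine ⟨K.toReal ^ (2 / r) + 1, by positivity, fun u hu hc ht => ?_⟩
  refine (rpow_setIntegral_le_of_bound hr0 (fun v hv h1 => ?_) ⟨hu, hc, ht⟩).trans
    (mul_le_mul_of_nonneg_right (le_add_of_nonneg_right zero_le_one)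
      (integral_nonneg fun z => sq_nonneg _))
  refine setIntegral_le_toReal_of_lintegral_le hK hv (H v hv ?_)
  rw [hv.lintegral_fderiv_sq]
  exact ENNReal.ofReal_le_one.2 h1
end
end

section
/- Let n ≥ 1, let Ω ⊂ ℝ^n be a smooth bounded domain, write d(x) = dist(x, ∂Ω), and let p satisfy 1 < p < ∞ if n = 1, 2 and 1 < p ≤ (n+2)/(n−2) if n ≥ 3. Then there exists a constant C > 0 depending only on n, p and Ω such that for every continuously differentiable function φ : closure(Ω) → ℝ one has ∫_Ω ( |∇φ(x)|² d(x)² + φ(x)² d(x)^{p+1} ) dx ≥ C ( ∫_Ω |φ(x)|^{p+1} d(x)^{p+1} dx )^{2/(p+1)}. -/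
open MeasureTheory Real Set

noncomputable section

/-- Distance to the boundary of `Ω`. -/
def dB {n : ℕ} (Ω : Set (EuclideanSpace ℝ (Fin n))) (x : EuclideanSpace ℝ (Fin n)) : ℝ :=
  Metric.infDist x (frontier Ω)

/-- A smooth bounded domain: a nonempty bounded open set which is the sublevel set
of a smooth defining function with nonvanishing gradient on the boundary. -/
def IsSmoothDomain {n : ℕ} (Ω : Set (EuclideanSpace ℝ (Fin n))) : Prop :=
  IsOpen Ω ∧ Bornology.IsBounded Ω ∧ Ω.Nonempty ∧
    ∃ Φ : EuclideanSpace ℝ (Fin n) → ℝ, ContDiff ℝ (⊤ : ℕ∞) Φ ∧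
      Ω = {x | Φ x < 0} ∧ frontier Ω = {x | Φ x = 0} ∧
      ∀ x ∈ frontier Ω, gradient Φ x ≠ 0

theorem infDist_frontier_le_dist {E : Type*} [NormedAddCommGroup E] [NormedSpace ℝ E]
    [FiniteDimensional ℝ E] {s : Set E} {x y : E} (hx : x ∈ s) (hy : y ∉ s) :
    Metric.infDist x (frontier s) ≤ dist x y := by
  obtain ⟨z, hz, hxz⟩ := exists_mem_frontier_infDist_compl_eq_dist hx
    (fun h => hy (h ▸ mem_univ y))
  calc Metric.infDist x (frontier s) ≤ dist x z := Metric.infDist_le_dist_of_mem hz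
    _ = Metric.infDist x sᶜ := hxz.symm
    _ ≤ dist x y := Metric.infDist_le_dist_of_mem hy

/-- A `C¹` function is dominated on a bounded set by the distance to a bounded set on which
it vanishes. -/
theorem exists_le_mul_infDist_of_contDiff {E : Type*} [NormedAddCommGroup E] [NormedSpace ℝ E]
    [FiniteDimensional ℝ E] {ρ : E → ℝ} (hρ : ContDiff ℝ 1 ρ) {s t : Set E}
    (hs : Bornology.IsBounded s) (ht : Bornology.IsBounded t) (htne : t.Nonempty)
    (h0 : ∀ y ∈ t, ρ y = 0) :
    ∃ L : ℝ, 0 < L ∧ ∀ x ∈ s, ρ x ≤ L * Metric.infDist x t := by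
  obtain ⟨R, hR⟩ := (hs.union ht).subset_closedBall 0
  obtain ⟨L, hL⟩ := (isCompact_closedBall (0 : E) R).exists_bound_of_continuousOn
    (hρ.continuous_fderiv one_ne_zero).continuousOn
  refine ⟨max L 1, by positivity, fun x hx => ?_⟩
  rw [← div_le_iff₀' (by positivity)]
  refine (Metric.le_infDist htne).2 fun {y} hy => ?_
  rw [div_le_iff₀' (by positivity)]
  have := (convex_closedBall (0 : E) R).norm_image_sub_le_of_norm_fderiv_le
    (fun z _ => hρ.differentiable one_ne_zero z) hL (hR (Or.inr hy)) (hR (Or.inl hx))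
  rw [h0 y hy, sub_zero, ← dist_eq_norm] at this
  exact (le_abs_self _).trans (this.trans (by gcongr; exact le_max_left _ _))

/-- Near a boundary point where a defining function has nonzero derivative, the distance to the
boundary is dominated by the defining function. -/
theorem exists_infDist_frontier_le_mul {E : Type*} [NormedAddCommGroup E] [NormedSpace ℝ E]
    [FiniteDimensional ℝ E] {ρ : E → ℝ} (hρ : ContDiff ℝ 1 ρ)
    (hb : Bornology.IsBounded {x | 0 < ρ x})
    (hg : ∀ x ∈ closure {x | 0 < ρ x}, ρ x = 0 → fderiv ℝ ρ x ≠ 0) :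
    ∃ K : ℝ, 0 < K ∧ ∀ x ∈ {x | 0 < ρ x},
      Metric.infDist x (frontier {x | 0 < ρ x}) ≤ K * ρ x := by
  set Ω := {x | 0 < ρ x} with hΩ
  have key : ∃ K : ℝ, 0 < K ∧ ∀ x ∈ closure Ω, 0 < ρ x →
      Metric.infDist x (frontier Ω) ≤ K * ρ x := by
    refine hb.isCompact_closure.induction_on
      (p := fun s => ∃ K : ℝ, 0 < K ∧ ∀ x ∈ s, 0 < ρ x →
        Metric.infDist x (frontier Ω) ≤ K * ρ x) ⟨1, one_pos, by simp⟩ ?_ ?_ ?_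
    · rintro s t hst ⟨K, hK, h⟩
      exact ⟨K, hK, fun x hx => h x (hst hx)⟩
    · rintro s t ⟨K, hK, h⟩ ⟨K', hK', h'⟩
      refine ⟨max K K', by positivity, fun x hx hpos => ?_⟩
      rcases hx with hx | hx
      · exact (h x hx hpos).trans (by gcongr; exact le_max_left _ _)
      · exact (h' x hx hpos).trans (by gcongr; exact le_max_right _ _)
    · intro z hz
      have hz0 : 0 ≤ ρ z := by
        have : closure Ω ⊆ {x | 0 ≤ ρ x} :=
          closure_minimal (fun x (hx : 0 < ρ x) => hx.le)
            (isClosed_le continuous_const hρ.continuous)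
        exact this hz
      rcases hz0.eq_or_lt with hz0 | hz0
      · have hne := hg z hz hz0.symm
        obtain ⟨v, hv⟩ : ∃ v, fderiv ℝ ρ z v ≠ 0 := by
          by_contra! h
          exact hne (ContinuousLinearMap.ext h)
        obtain ⟨v, hv⟩ : ∃ v, fderiv ℝ ρ z v = 2 :=
          ⟨(2 / fderiv ℝ ρ z v) • v, by simp [hv]⟩
        have hv0 : 0 < ‖v‖ := by
          rw [norm_pos_iff]
          rintro rfl
          simp at hv
        have hstrict := (hρ.contDiffAt (x := z)).hasStrictFDerivAt one_ne_zero
        have hev := hstrict.isLittleO.def (c := 1 / ‖v‖) (by positivity)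
        have hlim : Filter.Tendsto (fun x => (x - ρ x • v, x)) (nhds z) (nhds (z, z)) := by
          have : ContinuousAt (fun x => (x - ρ x • v, x)) z :=
            ((continuous_id.sub (hρ.continuous.smul continuous_const)).prodMk
              continuous_id).continuousAt
          simpa [ContinuousAt, ← hz0] using this
        refine ⟨_, mem_nhdsWithin_of_mem_nhds (hlim.eventually hev), ‖v‖, hv0, ?_⟩
        intro x hx hpos
        have hx' : ‖ρ (x - ρ x • v) - ρ x - fderiv ℝ ρ z (x - ρ x • v - x)‖
          ≤ 1 / ‖v‖ * ‖x - ρ x • v - x‖ := hx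
        have e : x - ρ x • v - x = -(ρ x • v) := by abel
        rw [e, norm_neg, map_neg, map_smul, hv, norm_smul, Real.norm_eq_abs, Real.norm_eq_abs,
          abs_of_pos hpos, mul_comm (ρ x) ‖v‖, ← mul_assoc, one_div, inv_mul_cancel₀ hv0.ne',
          smul_eq_mul, one_mul] at hx'
        have hy : x - ρ x • v ∉ Ω := by
          intro hmem
          have h1 : 0 < ρ (x - ρ x • v) := hmem
          have := (abs_le.1 hx').2
          linarith
        refine (infDist_frontier_le_dist (s := Ω) hpos hy).trans (le_of_eq ?_)
        rw [dist_eq_norm, sub_sub_cancel, norm_smul, Real.norm_eq_abs, abs_of_pos hpos, mul_comm]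
      · have h1 : ∀ᶠ x in nhds z, ρ z / 2 < ρ x :=
          hρ.continuous.continuousAt.eventually (lt_mem_nhds (half_lt_self hz0))
        have h2 : ∀ᶠ x in nhds z, Metric.infDist x (frontier Ω) <
            Metric.infDist z (frontier Ω) + 1 :=
          (Metric.continuous_infDist_pt _).continuousAt.eventually
            (gt_mem_nhds (lt_add_one _))
        have hd : 0 ≤ Metric.infDist z (frontier Ω) := Metric.infDist_nonneg
        refine ⟨_, mem_nhdsWithin_of_mem_nhds (h1.and h2),
          (Metric.infDist z (frontier Ω) + 1) / (ρ z / 2), by positivity, ?_⟩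
        rintro x ⟨hx1, hx2⟩ hpos
        rw [div_mul_eq_mul_div, le_div_iff₀ (by positivity)]
        gcongr
  obtain ⟨K, hK, h⟩ := key
  exact ⟨K, hK, fun x hx => h x (subset_closure hx) hx⟩

/-- A sequence of `C¹` functions vanishing near `(-∞, 0]`, with uniformly bounded derivatives,
that agree with the identity eventually near each positive number. -/
theorem exists_contDiff_truncation :
    ∃ (h : ℕ → ℝ → ℝ) (B : ℝ), (∀ k, ContDiff ℝ 1 (h k)) ∧
      (∀ k, ∃ ε > 0, ∀ t ≤ ε, h k t = 0) ∧
      (∀ k t, 0 ≤ t → 0 ≤ h k t ∧ h k t ≤ t) ∧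
      (∀ k t, |deriv (h k) t| ≤ B) ∧
      ∀ t > 0, ∀ᶠ k in Filter.atTop, h k t = t ∧ deriv (h k) t = 1 := by
  set g : ℝ → ℝ := fun s => s * Real.smoothTransition (s - 1) with hg
  have g_cd : ContDiff ℝ 1 g :=
    contDiff_id.mul (Real.smoothTransition.contDiff.comp (contDiff_id.sub contDiff_const))
  have g_zero : ∀ s ≤ 1, g s = 0 := fun s hs => by
    simp [hg, Real.smoothTransition.zero_of_nonpos (sub_nonpos.2 hs)]
  have g_id : ∀ s, 2 ≤ s → g s = s := fun s hs => by
    simp [hg, Real.smoothTransition.one_of_one_le (by linarith : 1 ≤ s - 1)]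
  have g_deriv : ∀ s, 2 < s → deriv g s = 1 := fun s hs => by
    have : g =ᶠ[nhds s] id := by
      filter_upwards [lt_mem_nhds hs] with t ht using g_id t ht.le
    rw [this.deriv_eq, deriv_id]
  have g_deriv0 : ∀ s < 1, deriv g s = 0 := fun s hs => by
    have : g =ᶠ[nhds s] fun _ => 0 := by
      filter_upwards [gt_mem_nhds hs] with t ht using g_zero t ht.le
    rw [this.deriv_eq, deriv_const]
  obtain ⟨B, hB⟩ := (isCompact_Icc (a := (1 : ℝ)) (b := 2)).exists_bound_of_continuousOn
    (g_cd.continuous_deriv le_rfl).continuousOn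
  have g_bound : ∀ s, |deriv g s| ≤ max B 1 := fun s => by
    rcases lt_or_ge s 1 with h1 | h1
    · simp [g_deriv0 s h1]
    rcases lt_or_ge 2 s with h2 | h2
    · simp [g_deriv s h2]
    exact (hB s ⟨h1, h2⟩).trans (le_max_left _ _)
  have hder : ∀ (k : ℕ) t, deriv (fun t => g ((k + 1) * t) / (k + 1)) t =
      deriv g ((k + 1) * t) := fun k t => by
    have h1 := (((g_cd.differentiable one_ne_zero).differentiableAt
      (x := ((k : ℝ) + 1) * t)).hasDerivAt.comp t
      ((hasDerivAt_id t).const_mul ((k : ℝ) + 1))).div_const ((k : ℝ) + 1)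
    have h2 : ((k : ℝ) + 1) ≠ 0 := by positivity
    refine h1.deriv.trans ?_
    field_simp
  refine ⟨fun k t => g ((k + 1) * t) / (k + 1), max B 1, fun k => ?_, fun k => ?_,
    fun k t ht => ?_, fun k t => ?_, fun t ht => ?_⟩
  · exact (g_cd.comp (contDiff_const.mul contDiff_id)).div_const _
  · refine ⟨1 / (k + 1), by positivity, fun t ht => ?_⟩
    rw [le_div_iff₀' (by positivity)] at ht
    simp [g_zero _ ht]
  · have h1 := Real.smoothTransition.nonneg (((k : ℝ) + 1) * t - 1)
    have h2 := Real.smoothTransition.le_one (((k : ℝ) + 1) * t - 1)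
    have h3 : g ((k + 1) * t) / (k + 1) =
        t * Real.smoothTransition (((k : ℝ) + 1) * t - 1) := by
      simp only [hg]
      field_simp
    simp only [h3]
    exact ⟨mul_nonneg ht h1, mul_le_of_le_one_right ht h2⟩
  · rw [hder]
    exact g_bound _
  · have hlim : Filter.Tendsto (fun k : ℕ => ((k : ℝ) + 1) * t) Filter.atTop Filter.atTop :=
      (Filter.tendsto_atTop_add_const_right _ _ tendsto_natCast_atTop_atTop).atTop_mul_const ht
    filter_upwards [hlim.eventually_gt_atTop 2] with k hk
    refine ⟨?_, ?_⟩
    · rw [g_id _ hk.le]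
      field_simp
    · rw [hder, g_deriv _ hk]

theorem eLpNorm_le_mul_eLpNorm_of_support_subset {α F : Type*} [MeasurableSpace α]
    [NormedAddCommGroup F] {μ : Measure α} {f : α → F} (hf : AEStronglyMeasurable f μ)
    {s : Set α} (hs : Function.support f ⊆ s) {p q : ENNReal} (hpq : p ≤ q) :
    eLpNorm f p μ ≤ eLpNorm f q μ * μ s ^ (1 / p.toReal - 1 / q.toReal) := by
  have := eLpNorm_le_eLpNorm_mul_rpow_measure_univ hpq (hf.restrict (s := s))
  rwa [eLpNorm_restrict_eq_of_support_subset hs, eLpNorm_restrict_eq_of_support_subset hs,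
    Measure.restrict_apply_univ] at this

theorem enorm_le_lintegral_fderiv_of_finrank_eq_one {E : Type*} [NormedAddCommGroup E]
    [InnerProductSpace ℝ E] [FiniteDimensional ℝ E] [MeasurableSpace E] [BorelSpace E]
    (hE : Module.finrank ℝ E = 1) {u : E → ℝ} (hu : ContDiff ℝ 1 u) (hc : HasCompactSupport u)
    (x : E) : ‖u x‖ₑ ≤ ∫⁻ y, ‖fderiv ℝ u y‖ₑ := by
  let e : ℝ ≃ₗᵢ[ℝ] E :=
    (stdOrthonormalBasis ℝ ℝ).equiv (stdOrthonormalBasis ℝ E) (finCongr (by simp [hE]))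
  have h1 : ContDiff ℝ 1 (u ∘ e) := hu.comp e.contDiff
  have h2 : HasCompactSupport (u ∘ e) := hc.comp_homeomorph e.toHomeomorph
  have h3 := HasCompactSupport.enorm_le_lintegral_Ici_deriv h1 h2 (e.symm x)
  have h4 : ∀ t, ‖deriv (u ∘ e) t‖ₑ ≤ ‖fderiv ℝ u (e t)‖ₑ := fun t => by
    have : HasDerivAt (u ∘ e) (fderiv ℝ u (e t) (e 1)) t := by
      have he : HasDerivAt e (e 1) t := e.toContinuousLinearEquiv.toContinuousLinearMap.hasDerivAt
      exact (hu.differentiable one_ne_zero (e t)).hasFDerivAt.comp_hasDerivAt t he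
    rw [this.deriv, ← ofReal_norm, ← ofReal_norm]
    refine ENNReal.ofReal_le_ofReal (((fderiv ℝ u (e t)).le_opNorm (e 1)).trans ?_)
    simp
  calc ‖u x‖ₑ = ‖(u ∘ e) (e.symm x)‖ₑ := by simp
    _ ≤ _ := h3
    _ ≤ ∫⁻ t, ‖deriv (u ∘ e) t‖ₑ := setLIntegral_le_lintegral _ _
    _ ≤ ∫⁻ t, ‖fderiv ℝ u (e t)‖ₑ := lintegral_mono h4
    _ = ∫⁻ y, ‖fderiv ℝ u y‖ₑ :=
      e.measurePreserving.lintegral_comp_emb e.toHomeomorph.measurableEmbedding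
        (fun y => ‖fderiv ℝ u y‖ₑ)

/-- The Sobolev inequality for `C¹` functions supported in a bounded set. -/
theorem exists_eLpNorm_le_mul_eLpNorm_fderiv_two {E : Type*} [NormedAddCommGroup E]
    [InnerProductSpace ℝ E] [FiniteDimensional ℝ E] [MeasurableSpace E] [BorelSpace E]
    (hE : 1 ≤ Module.finrank ℝ E) {q : NNReal} (hq : 2 < q)
    (hqc : Module.finrank ℝ E ≤ 2 ∨
      (2 : ℝ)⁻¹ - (Module.finrank ℝ E : ℝ)⁻¹ ≤ (q : ℝ)⁻¹)
    {s : Set E} (hs : Bornology.IsBounded s) :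
    ∃ C : NNReal, ∀ u : E → ℝ, ContDiff ℝ 1 u → Function.support u ⊆ s →
      eLpNorm u q volume ≤ C * eLpNorm (fderiv ℝ u) 2 volume := by
  have hfin : volume (closure s) < ⊤ := hs.isCompact_closure.measure_lt_top
  have hsupp : ∀ u : E → ℝ, Function.support u ⊆ s →
      Function.support (fderiv ℝ u) ⊆ closure s := fun u hu =>
    (support_fderiv_subset ℝ).trans (closure_mono hu)
  have hmeas : ∀ u : E → ℝ, ContDiff ℝ 1 u →
      AEStronglyMeasurable (fderiv ℝ u) (volume : Measure E) := fun u hu =>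
    (hu.continuous_fderiv one_ne_zero).aestronglyMeasurable
  have hcase : Module.finrank ℝ E = 1 ∨ Module.finrank ℝ E = 2 ∨ 3 ≤ Module.finrank ℝ E := by
    omega
  rcases hcase with h1 | h2 | h3
  · refine ⟨(volume (closure s) ^ (1 / (q : ℝ)) *
      volume (closure s) ^ (1 / (1 : ℝ) - 1 / (2 : ℝ))).toNNReal, fun u hu hus => ?_⟩
    rw [ENNReal.coe_toNNReal (by finiteness)]
    have hc : HasCompactSupport u := hs.isCompact_closure.of_isClosed_subset
      isClosed_closure (closure_mono hus)
    have hb : eLpNorm u q volume ≤ eLpNorm u ⊤ volume * volume (closure s) ^ (1 / (q : ℝ)) := by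
      simpa using eLpNorm_le_mul_eLpNorm_of_support_subset (p := q) (q := ⊤)
        hu.continuous.aestronglyMeasurable (hus.trans subset_closure) le_top
    have hd := eLpNorm_le_mul_eLpNorm_of_support_subset (p := 1) (q := 2)
      (hmeas u hu) (hsupp u hus) one_le_two
    have ht : eLpNorm u ⊤ volume ≤ eLpNorm (fderiv ℝ u) 1 volume := by
      rw [eLpNorm_exponent_top, eLpNorm_one_eq_lintegral_enorm]
      exact essSup_le_of_ae_le _ (Filter.Eventually.of_forall
        (enorm_le_lintegral_fderiv_of_finrank_eq_one h1 hu hc))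
    simp only [ENNReal.toReal_one, ENNReal.toReal_ofNat] at hd
    calc _ ≤ _ := hb
      _ ≤ (eLpNorm (fderiv ℝ u) 2 volume * volume (closure s) ^ (1 / (1 : ℝ) - 1 / (2 : ℝ))) *
          volume (closure s) ^ (1 / (q : ℝ)) := by gcongr; exact ht.trans hd
      _ = _ := by ring
  · have hq' : (2 : ℝ) < q := by exact_mod_cast hq
    set r : NNReal := (2⁻¹ + q⁻¹)⁻¹ with hr
    have hqinv : (q : ℝ)⁻¹ < 2⁻¹ := inv_strictAnti₀ two_pos hq'
    have hqpos : 0 < (q : ℝ)⁻¹ := by positivity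
    have hrR : (r : ℝ) = (2⁻¹ + (q : ℝ)⁻¹)⁻¹ := by simp [hr]
    have hr1 : 1 ≤ r := by
      rw [← NNReal.coe_le_coe, hrR, NNReal.coe_one]
      exact (one_le_inv₀ (by positivity)).2 (by linarith)
    have hr2 : (r : ℝ) < 2 := by
      rw [hrR, inv_lt_comm₀ (by positivity) two_pos]
      linarith
    refine ⟨eLpNormLESNormFDerivOfLeConst ℝ (volume : Measure E) s r q *
      (volume (closure s) ^ (1 / (r : ℝ) - 1 / (2 : ℝ))).toNNReal, fun u hu hus => ?_⟩
    have h := eLpNorm_le_eLpNorm_fderiv_of_le (μ := (volume : Measure E)) hu hus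
      (p := r) (q := q) hr1 (by rw [h2]; exact_mod_cast hr2)
      (by rw [h2, NNReal.coe_inv, hrR, inv_inv]; push_cast; linarith) hs
    have hd := eLpNorm_le_mul_eLpNorm_of_support_subset (p := r) (q := 2)
      (hmeas u hu) (hsupp u hus) (by exact_mod_cast hr2.le)
    simp only [ENNReal.coe_toReal, ENNReal.toReal_ofNat] at hd
    have hexp : 0 ≤ 1 / (r : ℝ) - 1 / (2 : ℝ) := by
      rw [one_div, hrR, inv_inv]; linarith
    rw [ENNReal.coe_mul, ENNReal.coe_toNNReal (by finiteness)]
    calc _ ≤ _ := h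
      _ ≤ eLpNormLESNormFDerivOfLeConst ℝ (volume : Measure E) s r q *
          (eLpNorm (fderiv ℝ u) 2 volume *
            volume (closure s) ^ (1 / (r : ℝ) - 1 / (2 : ℝ))) := by gcongr
      _ = _ := by ring
  · have hqc' := hqc.resolve_left (by omega)
    refine ⟨eLpNormLESNormFDerivOfLeConst ℝ (volume : Measure E) s 2 q, fun u hu hus => ?_⟩
    exact_mod_cast eLpNorm_le_eLpNorm_fderiv_of_le (μ := (volume : Measure E)) hu hus
      (p := 2) (q := q) one_le_two (by exact_mod_cast h3) (by simpa using hqc') hs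

theorem Continuous.integrableOn_of_isBounded {E F : Type*} [PseudoMetricSpace E] [ProperSpace E]
    [MeasurableSpace E] [BorelSpace E] {μ : Measure E} [IsFiniteMeasureOnCompacts μ]
    [NormedAddCommGroup F] {f : E → F} (hf : Continuous f) {s : Set E}
    (hs : Bornology.IsBounded s) : IntegrableOn f s μ :=
  (hf.continuousOn.integrableOn_compact' hs.isCompact_closure
    isClosed_closure.measurableSet).mono_set subset_closure

theorem Bornology.IsBounded.exists_bound_of_continuous {E F : Type*} [PseudoMetricSpace E]
    [ProperSpace E] [SeminormedAddCommGroup F] {s : Set E} (hs : Bornology.IsBounded s)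
    {f : E → F} (hf : Continuous f) : ∃ C : ℝ, 0 ≤ C ∧ ∀ x ∈ s, ‖f x‖ ≤ C := by
  obtain ⟨C, hC⟩ := hs.isCompact_closure.exists_bound_of_continuousOn hf.continuousOn
  exact ⟨max C 0, le_max_right _ _, fun x hx => (hC x (subset_closure hx)).trans (le_max_left _ _)⟩

theorem support_truncation_mul_subset {α : Type*} {ρ : α → ℝ} {h : ℝ → ℝ} {ε : ℝ}
    (h0 : ∀ t ≤ ε, h t = 0) (f : α → ℝ) :
    Function.support (fun x => h (ρ x) * f x) ⊆ {x | ε ≤ ρ x} := by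
  intro x hx
  by_contra hlt
  exact hx (by simp [h0 _ (not_le.1 hlt).le])

theorem hasCompactSupport_truncation_mul {X : Type*} [PseudoMetricSpace X] [ProperSpace X]
    {ρ : X → ℝ} (hρ : Continuous ρ)
    (hb : Bornology.IsBounded {x | 0 < ρ x}) {h : ℝ → ℝ} {ε : ℝ} (hε : 0 < ε)
    (h0 : ∀ t ≤ ε, h t = 0) (f : X → ℝ) : HasCompactSupport fun x => h (ρ x) * f x := by
  have hcl : IsClosed {x | ε ≤ ρ x} := isClosed_le continuous_const hρ
  exact (Metric.isCompact_of_isClosed_isBounded hcl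
    (hb.subset fun x hx => lt_of_lt_of_le hε hx)).of_isClosed_subset isClosed_closure
    (closure_minimal (support_truncation_mul_subset h0 f) hcl)

theorem fderiv_truncation_mul_eq_zero {E : Type*} [NormedAddCommGroup E] [NormedSpace ℝ E]
    {ρ : E → ℝ} (hρ : Continuous ρ) {h : ℝ → ℝ} {ε : ℝ} (hε : 0 < ε)
    (h0 : ∀ t ≤ ε, h t = 0) (f : E → ℝ) {x : E} (hx : x ∉ {x | 0 < ρ x}) :
    fderiv ℝ (fun x => h (ρ x) * f x) x = 0 := by
  by_contra hne
  have hcl : IsClosed {x | ε ≤ ρ x} := isClosed_le continuous_const hρ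
  have : ε ≤ ρ x := closure_minimal (support_truncation_mul_subset h0 f) hcl
    (support_fderiv_subset ℝ hne)
  exact hx (hε.trans_le this)

theorem fderiv_truncation_mul {E : Type*} [NormedAddCommGroup E] [NormedSpace ℝ E]
    {ρ : E → ℝ} (hρ : ContDiff ℝ 1 ρ) {h : ℝ → ℝ} (hh : ContDiff ℝ 1 h)
    {f : E → ℝ} (hf : ContDiff ℝ 1 f) (x : E) :
    fderiv ℝ (fun x => h (ρ x) * f x) x =
      h (ρ x) • fderiv ℝ f x + (f x * deriv h (ρ x)) • fderiv ℝ ρ x := by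
  have h1 : HasFDerivAt (fun x => h (ρ x)) (deriv h (ρ x) • fderiv ℝ ρ x) x :=
    (hh.differentiable one_ne_zero (ρ x)).hasDerivAt.comp_hasFDerivAt x
      (hρ.differentiable one_ne_zero x).hasFDerivAt
  rw [← smul_smul]
  exact (h1.mul (hf.differentiable one_ne_zero x).hasFDerivAt).fderiv

section WeightedSobolev

variable {E : Type*} [NormedAddCommGroup E] [InnerProductSpace ℝ E] [FiniteDimensional ℝ E]

theorem norm_gradient_eq_norm_fderiv_s5 (f : E → ℝ) (x : E) :
    ‖gradient f x‖ = ‖fderiv ℝ f x‖ := by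
  rw [← toDual_gradient, LinearIsometryEquiv.norm_map]

theorem fderiv_gradient_self (f : E → ℝ) (x : E) :
    fderiv ℝ f x (gradient f x) = ‖fderiv ℝ f x‖ ^ 2 := by
  rw [← inner_gradient_left, real_inner_self_eq_norm_sq, norm_gradient_eq_norm_fderiv_s5]

theorem ContDiff.continuous_gradient {f : E → ℝ} (hf : ContDiff ℝ 1 f) :
    Continuous (gradient f) :=
  (InnerProductSpace.toDual ℝ E).symm.continuous.comp (hf.continuous_fderiv one_ne_zero)

variable [MeasurableSpace E] [BorelSpace E]

/-- Green's first identity for a compactly supported test function. -/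
theorem exists_integral_mul_eq_neg_integral_fderiv_gradient {ρ : E → ℝ} (hρ : ContDiff ℝ 2 ρ) :
    ∃ l : E → ℝ, Continuous l ∧ ∀ f : E → ℝ, ContDiff ℝ 1 f → HasCompactSupport f →
      ∫ x, f x * l x = -∫ x, fderiv ℝ f x (gradient ρ x) := by
  have hρ' : ∀ v, ContDiff ℝ 1 (fun y => fderiv ℝ ρ y v) := fun v =>
    (hρ.fderiv_right (m := 1) (by norm_num)).clm_apply contDiff_const
  have hcont : ∀ {f : E → ℝ}, ContDiff ℝ 1 f → ∀ v, Continuous (fun y => fderiv ℝ f y v) :=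
    fun hf v => (hf.continuous_fderiv one_ne_zero).clm_apply continuous_const
  let b := stdOrthonormalBasis ℝ E
  refine ⟨fun x => ∑ i, fderiv ℝ (fun y => fderiv ℝ ρ y (b i)) x (b i),
    continuous_finsetSum _ fun i _ => hcont (hρ' _) _, fun f hf hc => ?_⟩
  have hfs : ∀ v, HasCompactSupport (fun y => fderiv ℝ f y v) := fun v => hc.fderiv_apply ℝ v
  have hi1 : ∀ i, Integrable fun x => f x * fderiv ℝ (fun y => fderiv ℝ ρ y (b i)) x (b i) :=
    fun i => (hf.continuous.mul (hcont (hρ' _) _)).integrable_of_hasCompactSupport hc.mul_right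
  have hi2 : ∀ i, Integrable fun x => fderiv ℝ f x (b i) * fderiv ℝ ρ x (b i) :=
    fun i => ((hcont hf _).mul (hρ' _).continuous).integrable_of_hasCompactSupport
      (hfs _).mul_right
  have hsum : ∀ x, fderiv ℝ f x (gradient ρ x) =
      ∑ i, fderiv ℝ f x (b i) * fderiv ℝ ρ x (b i) := fun x => by
    conv_lhs => rw [← b.sum_repr' (gradient ρ x)]
    simp only [map_sum, map_smul, smul_eq_mul, inner_gradient_right, conj_trivial]
    exact Finset.sum_congr rfl fun i _ => mul_comm _ _
  simp only [hsum, Finset.mul_sum]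
  rw [integral_finsetSum _ fun i _ => hi1 i, integral_finsetSum _ fun i _ => hi2 i,
    ← Finset.sum_neg_distrib]
  refine Finset.sum_congr rfl fun i _ => ?_
  exact integral_mul_fderiv_eq_neg_fderiv_mul_of_integrable (hi2 i) (hi1 i)
    ((hf.continuous.mul (hρ' _).continuous).integrable_of_hasCompactSupport hc.mul_right)
    (fun x _ => hf.differentiable one_ne_zero x) (fun x _ => (hρ' _).differentiable one_ne_zero x)

/-- The truncated form of the integration by parts behind Hardy's inequality. -/
theorem exists_setIntegral_deriv_truncation_le {ρ : E → ℝ} (hρ : ContDiff ℝ 2 ρ)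
    (hb : Bornology.IsBounded {x | 0 < ρ x}) :
    ∃ M : ℝ, 0 ≤ M ∧ ∀ (h : ℝ → ℝ), ContDiff ℝ 1 h → (∃ ε > 0, ∀ t ≤ ε, h t = 0) →
      (∀ t, 0 ≤ t → 0 ≤ h t ∧ h t ≤ t) → ∀ φ : E → ℝ, ContDiff ℝ 1 φ →
      ∫ x in {x | 0 < ρ x}, deriv h (ρ x) * (‖fderiv ℝ ρ x‖ ^ 2 * φ x ^ 2) ≤
        ∫ x in {x | 0 < ρ x}, M * (ρ x * φ x ^ 2 + ρ x * (|φ x| * ‖fderiv ℝ φ x‖)) := by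
  obtain ⟨l, hl, hgreen⟩ := exists_integral_mul_eq_neg_integral_fderiv_gradient hρ
  have hρ1 : ContDiff ℝ 1 ρ := hρ.of_le (by norm_num)
  have hc := hρ1.continuous
  have hmeas : MeasurableSet {x | 0 < ρ x} := (isOpen_lt continuous_const hc).measurableSet
  obtain ⟨M₁, hM₁, hM₁'⟩ := hb.exists_bound_of_continuous hl
  obtain ⟨M₂, hM₂, hM₂'⟩ := hb.exists_bound_of_continuous hρ1.continuous_gradient
  refine ⟨M₁ + 2 * M₂, by positivity, ?_⟩
  rintro h hh ⟨ε, hε, h0⟩ hle φ hφ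
  have hf : ContDiff ℝ 1 fun x => h (ρ x) * φ x ^ 2 := (hh.comp hρ1).mul (hφ.pow 2)
  have hDf : ∀ x, fderiv ℝ (fun x => h (ρ x) * φ x ^ 2) x (gradient ρ x) =
      h (ρ x) * (2 * φ x * fderiv ℝ φ x (gradient ρ x)) +
        deriv h (ρ x) * (‖fderiv ℝ ρ x‖ ^ 2 * φ x ^ 2) := fun x => by
    have h2 : fderiv ℝ (fun x => φ x ^ 2) x = (2 * φ x) • fderiv ℝ φ x := by
      rw [((hφ.differentiable one_ne_zero x).hasFDerivAt.pow 2).fderiv]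
      simp
    rw [fderiv_truncation_mul hρ1 hh (hφ.pow 2), h2]
    simp only [add_apply, smul_apply, smul_eq_mul,
      fderiv_gradient_self]
    ring
  have hgrad : Continuous (gradient ρ) := hρ1.continuous_gradient
  have hφD : Continuous (fderiv ℝ φ) := hφ.continuous_fderiv one_ne_zero
  have hρD : Continuous (fderiv ℝ ρ) := hρ1.continuous_fderiv one_ne_zero
  have hh' : Continuous (deriv h) := hh.continuous_deriv le_rfl
  have hφc := hφ.continuous
  have hhc := hh.continuous
  have hfD := hf.continuous_fderiv one_ne_zero
  have e1 : ∫ x in {x | 0 < ρ x}, fderiv ℝ (fun x => h (ρ x) * φ x ^ 2) x (gradient ρ x) =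
      -∫ x in {x | 0 < ρ x}, h (ρ x) * φ x ^ 2 * l x := by
    rw [setIntegral_eq_integral_of_forall_compl_eq_zero,
      setIntegral_eq_integral_of_forall_compl_eq_zero,
      hgreen _ hf (hasCompactSupport_truncation_mul hc hb hε h0 _), neg_neg]
    · intro x hx
      rw [h0 _ ((not_lt.1 hx).trans hε.le), zero_mul, zero_mul]
    · intro x hx
      rw [fderiv_truncation_mul_eq_zero hc hε h0 _ hx, zero_apply]
  have e2 : ∫ x in {x | 0 < ρ x}, deriv h (ρ x) * (‖fderiv ℝ ρ x‖ ^ 2 * φ x ^ 2) =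
      ∫ x in {x | 0 < ρ x}, (-(h (ρ x) * φ x ^ 2 * l x) -
        h (ρ x) * (2 * φ x * fderiv ℝ φ x (gradient ρ x))) := by
    rw [integral_sub, integral_neg, ← e1, ← integral_sub]
    · simp only [hDf, add_sub_cancel_left]
    all_goals exact Continuous.integrableOn_of_isBounded (by fun_prop) hb
  rw [e2]
  refine setIntegral_mono_on (Continuous.integrableOn_of_isBounded (by fun_prop) hb)
    (Continuous.integrableOn_of_isBounded (by fun_prop) hb) hmeas fun x hx => ?_
  obtain ⟨hh0, hhρ⟩ := hle _ (le_of_lt hx)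
  have hx0 : 0 < ρ x := hx
  have b1 : |h (ρ x) * φ x ^ 2 * l x| ≤ ρ x * φ x ^ 2 * M₁ := by
    rw [abs_mul, abs_mul, abs_of_nonneg hh0, abs_of_nonneg (sq_nonneg _)]
    gcongr
    exact hM₁' x hx
  have b2 : |h (ρ x) * (2 * φ x * fderiv ℝ φ x (gradient ρ x))| ≤
      ρ x * (2 * |φ x| * (‖fderiv ℝ φ x‖ * M₂)) := by
    rw [abs_mul, abs_mul, abs_mul, abs_of_nonneg hh0, abs_two]
    gcongr
    exact ((fderiv ℝ φ x).le_opNorm _).trans (by gcongr; exact hM₂' x hx)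
  have p1 : 0 ≤ ρ x * φ x ^ 2 := by positivity
  have p2 : 0 ≤ ρ x * (|φ x| * ‖fderiv ℝ φ x‖) := by positivity
  nlinarith [neg_abs_le (h (ρ x) * φ x ^ 2 * l x),
    neg_abs_le (h (ρ x) * (2 * φ x * fderiv ℝ φ x (gradient ρ x))),
    mul_nonneg p1 hM₂, mul_nonneg p2 hM₁]

theorem exists_mul_le_add_mul_rpow {q : ℝ} (hq : 1 ≤ q) {N δ : ℝ} (hN : 0 < N) (hδ : 0 < δ) :
    ∃ K : ℝ, 0 ≤ K ∧ ∀ t, 0 < t → N * t ≤ δ + K * t ^ q := by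
  refine ⟨N * (δ / N) ^ (1 - q), by positivity, fun t ht => ?_⟩
  have hK : 0 ≤ N * (δ / N) ^ (1 - q) * t ^ q := by positivity
  rcases le_or_gt (N * t) δ with h | h
  · linarith
  · have h1 : δ / N ≤ t := by rw [div_le_iff₀' hN]; exact h.le
    have h2 : t ^ (1 - q) ≤ (δ / N) ^ (1 - q) :=
      Real.rpow_le_rpow_of_nonpos (by positivity) h1 (by linarith)
    have h3 : t = t ^ (1 - q) * t ^ q := by
      rw [← Real.rpow_add ht, sub_add_cancel, Real.rpow_one]
    calc N * t = N * (t ^ (1 - q) * t ^ q) := by rw [← h3]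
      _ ≤ N * ((δ / N) ^ (1 - q) * t ^ q) := by gcongr
      _ ≤ _ := by rw [← mul_assoc]; linarith

/-- A weighted Hardy inequality. -/
theorem exists_setIntegral_sq_le {ρ : E → ℝ} (hρ : ContDiff ℝ 2 ρ)
    (hb : Bornology.IsBounded {x | 0 < ρ x})
    (hg : ∀ x ∈ closure {x | 0 < ρ x}, ρ x = 0 → fderiv ℝ ρ x ≠ 0) {q : ℝ} (hq : 1 ≤ q) :
    ∃ C : ℝ, 0 ≤ C ∧ ∀ φ : E → ℝ, ContDiff ℝ 1 φ →
      ∫ x in {x | 0 < ρ x}, φ x ^ 2 ≤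
        C * ∫ x in {x | 0 < ρ x}, (‖fderiv ℝ φ x‖ ^ 2 * ρ x ^ 2 + φ x ^ 2 * ρ x ^ q) := by
  have hρ1 : ContDiff ℝ 1 ρ := hρ.of_le (by norm_num)
  have hc := hρ1.continuous
  have hmeas : MeasurableSet {x | 0 < ρ x} := (isOpen_lt continuous_const hc).measurableSet
  have hρD : Continuous (fderiv ℝ ρ) := hρ1.continuous_fderiv one_ne_zero
  obtain ⟨M, hM, hcut⟩ := exists_setIntegral_deriv_truncation_le hρ hb
  obtain ⟨h, B, hh, hh0, hhle, hhB, hhlim⟩ := exists_contDiff_truncation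
  obtain ⟨c, hc0, hcle⟩ := hb.isCompact_closure.exists_forall_le'
    (f := fun x => ‖fderiv ℝ ρ x‖ ^ 2 + ρ x) (a := 0) (by fun_prop) fun x hx => by
      have h0 : 0 ≤ ρ x := closure_minimal (fun x (hx : 0 < ρ x) => hx.le)
        (isClosed_le continuous_const hc) hx
      rcases h0.eq_or_lt with h0 | h0
      · have := norm_pos_iff.2 (hg x hx h0.symm)
        positivity
      · positivity
  obtain ⟨K, hK, hKle⟩ := exists_mul_le_add_mul_rpow hq (N := M + 1) (δ := c / 4)
    (by positivity) (by positivity)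
  refine ⟨2 * (K + M ^ 2 / c) / c, by positivity, fun φ hφ => ?_⟩
  have hφc := hφ.continuous
  have hφD : Continuous (fderiv ℝ φ) := hφ.continuous_fderiv one_ne_zero
  have hρq : Continuous fun x => ρ x ^ q := hc.rpow_const fun _ => Or.inr (by linarith)
  have hlim : Filter.Tendsto
      (fun k => ∫ x in {x | 0 < ρ x}, deriv (h k) (ρ x) * (‖fderiv ℝ ρ x‖ ^ 2 * φ x ^ 2))
      Filter.atTop (nhds (∫ x in {x | 0 < ρ x}, ‖fderiv ℝ ρ x‖ ^ 2 * φ x ^ 2)) := by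
    refine tendsto_integral_of_dominated_convergence
      (fun x => B * (‖fderiv ℝ ρ x‖ ^ 2 * φ x ^ 2)) (fun k => ?_)
      (Continuous.integrableOn_of_isBounded (by fun_prop) hb) (fun k => ?_) ?_
    · have := (hh k).continuous_deriv le_rfl
      exact Continuous.aestronglyMeasurable (by fun_prop)
    · refine Filter.Eventually.of_forall fun x => ?_
      rw [Real.norm_eq_abs, abs_mul, abs_of_nonneg (a := ‖fderiv ℝ ρ x‖ ^ 2 * φ x ^ 2)
        (by positivity)]
      gcongr
      exact hhB k _
    · refine (ae_restrict_iff' hmeas).2 (Filter.Eventually.of_forall fun x hx => ?_)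
      refine tendsto_const_nhds.congr' ?_
      filter_upwards [hhlim _ hx] with k hk
      rw [hk.2, one_mul]
  have hH := le_of_tendsto' hlim fun k => hcut (h k) (hh k) (hh0 k) (hhle k) φ hφ
  have hint : ∀ {f : E → ℝ}, Continuous f → IntegrableOn f {x | 0 < ρ x} := fun hf =>
    hf.integrableOn_of_isBounded hb
  have e1 : c * ∫ x in {x | 0 < ρ x}, φ x ^ 2 ≤
      (∫ x in {x | 0 < ρ x}, ‖fderiv ℝ ρ x‖ ^ 2 * φ x ^ 2) +
        ∫ x in {x | 0 < ρ x}, ρ x * φ x ^ 2 := by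
    rw [← integral_add (hint (by fun_prop)) (hint (by fun_prop)), ← integral_const_mul]
    refine setIntegral_mono_on (hint (by fun_prop)) (hint (by fun_prop)) hmeas fun x hx => ?_
    rw [← add_mul]
    exact mul_le_mul_of_nonneg_right (hcle x (subset_closure hx)) (sq_nonneg _)
  have e2 : (∫ x in {x | 0 < ρ x}, M * (ρ x * φ x ^ 2 + ρ x * (|φ x| * ‖fderiv ℝ φ x‖))) +
      ∫ x in {x | 0 < ρ x}, ρ x * φ x ^ 2 ≤
      c / 2 * (∫ x in {x | 0 < ρ x}, φ x ^ 2) + (K + M ^ 2 / c) *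
        ∫ x in {x | 0 < ρ x}, (‖fderiv ℝ φ x‖ ^ 2 * ρ x ^ 2 + φ x ^ 2 * ρ x ^ q) := by
    rw [← integral_add (hint (by fun_prop)) (hint (by fun_prop)), ← integral_const_mul,
      ← integral_const_mul, ← integral_add (hint (by fun_prop)) (hint (by fun_prop))]
    refine setIntegral_mono_on (hint (by fun_prop)) (hint (by fun_prop)) hmeas fun x hx => ?_
    have hx0 : 0 < ρ x := hx
    have a1 := mul_le_mul_of_nonneg_right (hKle (ρ x) hx) (sq_nonneg (φ x))
    have a2 : |φ x| * (M * ρ x * ‖fderiv ℝ φ x‖) ≤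
        c / 4 * φ x ^ 2 + M ^ 2 / c * (‖fderiv ℝ φ x‖ ^ 2 * ρ x ^ 2) := by
      have h1 : 0 ≤ (c / 2 * |φ x| - M * ρ x * ‖fderiv ℝ φ x‖) ^ 2 / c := by positivity
      have h2 : (c / 2 * |φ x| - M * ρ x * ‖fderiv ℝ φ x‖) ^ 2 / c = c / 4 * |φ x| ^ 2 +
          M ^ 2 / c * (‖fderiv ℝ φ x‖ ^ 2 * ρ x ^ 2) -
            |φ x| * (M * ρ x * ‖fderiv ℝ φ x‖) := by
        field_simp
        ring
      rw [sq_abs] at h2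
      linarith
    have p1 : 0 ≤ K * (‖fderiv ℝ φ x‖ ^ 2 * ρ x ^ 2) := by positivity
    have p2 : 0 ≤ M ^ 2 / c * (φ x ^ 2 * ρ x ^ q) := by positivity
    linarith
  have e3 : c / 2 * ∫ x in {x | 0 < ρ x}, φ x ^ 2 ≤ (K + M ^ 2 / c) *
      ∫ x in {x | 0 < ρ x}, (‖fderiv ℝ φ x‖ ^ 2 * ρ x ^ 2 + φ x ^ 2 * ρ x ^ q) := by
    linarith
  rw [div_mul_eq_mul_div, le_div_iff₀ hc0]
  linarith

/-- The Sobolev inequality for `C¹` functions supported in a bounded set, with Bochner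
integrals. -/
theorem exists_integral_rpow_le_mul_integral_fderiv_sq (hE : 1 ≤ Module.finrank ℝ E) {q : ℝ}
    (hq : 2 < q) (hqc : Module.finrank ℝ E ≤ 2 ∨
      (2 : ℝ)⁻¹ - (Module.finrank ℝ E : ℝ)⁻¹ ≤ q⁻¹)
    {s : Set E} (hs : Bornology.IsBounded s) :
    ∃ C : ℝ, 0 ≤ C ∧ ∀ u : E → ℝ, ContDiff ℝ 1 u → Function.support u ⊆ s →
      (∫ x, |u x| ^ q) ^ (2 / q) ≤ C * ∫ x, ‖fderiv ℝ u x‖ ^ 2 := by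
  lift q to NNReal using by linarith
  obtain ⟨C, hC⟩ := exists_eLpNorm_le_mul_eLpNorm_fderiv_two hE
    (by exact_mod_cast hq) hqc hs
  refine ⟨(C : ℝ) ^ 2, by positivity, fun u hu hus => ?_⟩
  have hc : HasCompactSupport u := hs.isCompact_closure.of_isClosed_subset
    isClosed_closure (closure_mono hus)
  have hq0 : (0 : ℝ) < q := by linarith
  have h := hC u hu hus
  rw [(hu.continuous.memLp_of_hasCompactSupport hc).eLpNorm_eq_integral_rpow_norm
      (by simpa using hq0.ne') (by simp),
    ((hu.continuous_fderiv one_ne_zero).memLp_of_hasCompactSupport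
      (hc.fderiv ℝ)).eLpNorm_eq_integral_rpow_norm (by simp) (by simp),
    ← ENNReal.ofReal_coe_nnreal (p := C), ← ENNReal.ofReal_mul (by positivity),
    ENNReal.ofReal_le_ofReal_iff (by positivity)] at h
  simp only [ENNReal.coe_toReal, ENNReal.toReal_ofNat, Real.norm_eq_abs, Real.rpow_two] at h
  have h2 := pow_le_pow_left₀ (by positivity) h 2
  rw [mul_pow, ← Real.rpow_natCast, ← Real.rpow_natCast (_ ^ (2 : ℝ)⁻¹),
    ← Real.rpow_mul (by positivity), ← Real.rpow_mul (by positivity)] at h2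
  simpa [div_eq_inv_mul] using h2

/-- The weighted Sobolev inequality, with a defining function as weight. -/
theorem exists_setIntegral_mul_rpow_le {ρ : E → ℝ} (hρ : ContDiff ℝ 2 ρ)
    (hb : Bornology.IsBounded {x | 0 < ρ x})
    (hg : ∀ x ∈ closure {x | 0 < ρ x}, ρ x = 0 → fderiv ℝ ρ x ≠ 0)
    (hE : 1 ≤ Module.finrank ℝ E) {q : ℝ} (hq : 2 < q)
    (hqc : Module.finrank ℝ E ≤ 2 ∨ (2 : ℝ)⁻¹ - (Module.finrank ℝ E : ℝ)⁻¹ ≤ q⁻¹) :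
    ∃ C : ℝ, 0 < C ∧ ∀ φ : E → ℝ, ContDiff ℝ 1 φ →
      (∫ x in {x | 0 < ρ x}, |φ x| ^ q * ρ x ^ q) ^ (2 / q) ≤
        C * ∫ x in {x | 0 < ρ x}, (‖fderiv ℝ φ x‖ ^ 2 * ρ x ^ 2 + φ x ^ 2 * ρ x ^ q) := by
  have hρ1 : ContDiff ℝ 1 ρ := hρ.of_le (by norm_num)
  have hc := hρ1.continuous
  have hmeas : MeasurableSet {x | 0 < ρ x} := (isOpen_lt continuous_const hc).measurableSet
  have hρD : Continuous (fderiv ℝ ρ) := hρ1.continuous_fderiv one_ne_zero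
  obtain ⟨C₁, hC₁, hhardy⟩ := exists_setIntegral_sq_le hρ hb hg (by linarith : 1 ≤ q)
  obtain ⟨C₂, hC₂, hsob⟩ := exists_integral_rpow_le_mul_integral_fderiv_sq hE hq hqc hb
  obtain ⟨h, B, hh, hh0, hhle, hhB, hhlim⟩ := exists_contDiff_truncation
  obtain ⟨G, hG, hGle⟩ := hb.exists_bound_of_continuous hρD
  refine ⟨C₂ * (2 + 2 * (B * G) ^ 2 * C₁) + 1, by positivity, fun φ hφ => ?_⟩
  have hφc := hφ.continuous
  have hφD : Continuous (fderiv ℝ φ) := hφ.continuous_fderiv one_ne_zero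
  have hρq : Continuous fun x => ρ x ^ q := hc.rpow_const fun _ => Or.inr (by linarith)
  have hint : ∀ {f : E → ℝ}, Continuous f → IntegrableOn f {x | 0 < ρ x} := fun hf =>
    hf.integrableOn_of_isBounded hb
  have hpow : Continuous fun t : ℝ => |t| ^ q :=
    continuous_abs.rpow_const fun _ => Or.inr (by linarith)
  set I := ∫ x in {x | 0 < ρ x}, (‖fderiv ℝ φ x‖ ^ 2 * ρ x ^ 2 + φ x ^ 2 * ρ x ^ q) with hI
  have hI0 : 0 ≤ I := setIntegral_nonneg hmeas fun x hx => by
    have hx0 : 0 < ρ x := hx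
    positivity
  have hlim : Filter.Tendsto (fun k => ∫ x in {x | 0 < ρ x}, |h k (ρ x) * φ x| ^ q)
      Filter.atTop (nhds (∫ x in {x | 0 < ρ x}, |φ x| ^ q * ρ x ^ q)) := by
    refine tendsto_integral_of_dominated_convergence (fun x => |ρ x * φ x| ^ q) (fun k => ?_)
      (hint (hpow.comp (by fun_prop))) (fun k => ?_) ?_
    · have := (hh k).continuous
      exact (hpow.comp (by fun_prop : Continuous fun x => h k (ρ x) * φ x)).aestronglyMeasurable
    · refine (ae_restrict_iff' hmeas).2 (Filter.Eventually.of_forall fun x hx => ?_)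
      obtain ⟨h1, h2⟩ := hhle k _ (le_of_lt hx)
      rw [Real.norm_eq_abs, abs_of_nonneg (by positivity), abs_mul, abs_mul, abs_of_nonneg h1,
        abs_of_nonneg (h1.trans h2)]
      gcongr
    · refine (ae_restrict_iff' hmeas).2 (Filter.Eventually.of_forall fun x hx => ?_)
      have hx0 : 0 < ρ x := hx
      refine tendsto_const_nhds.congr' ?_
      filter_upwards [hhlim _ hx] with k hk
      rw [hk.1, abs_mul, abs_of_pos hx0, Real.mul_rpow hx0.le (abs_nonneg _), mul_comm]
  have hlim' := hlim.rpow_const (p := 2 / q) (Or.inr (by positivity))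
  refine le_of_tendsto' hlim' fun k => ?_
  obtain ⟨ε, hε, h0⟩ := hh0 k
  have hu : ContDiff ℝ 1 fun x => h k (ρ x) * φ x := ((hh k).comp hρ1).mul hφ
  have hsupp : Function.support (fun x => h k (ρ x) * φ x) ⊆ {x | 0 < ρ x} :=
    (support_truncation_mul_subset h0 φ).trans fun x hx => lt_of_lt_of_le hε hx
  have hs := hsob _ hu hsupp
  rw [← setIntegral_eq_integral_of_forall_compl_eq_zero (s := {x | 0 < ρ x}),
    ← setIntegral_eq_integral_of_forall_compl_eq_zero (s := {x | 0 < ρ x})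
      (f := fun x => ‖fderiv ℝ (fun x => h k (ρ x) * φ x) x‖ ^ 2)] at hs
  rotate_left
  · intro x hx
    simp [fderiv_truncation_mul_eq_zero hc hε h0 φ hx]
  · intro x hx
    rw [h0 _ ((not_lt.1 hx).trans hε.le), zero_mul, abs_zero, Real.zero_rpow (by linarith)]
  have hD : ∫ x in {x | 0 < ρ x}, ‖fderiv ℝ (fun x => h k (ρ x) * φ x) x‖ ^ 2 ≤
      2 * I + 2 * (B * G) ^ 2 * ∫ x in {x | 0 < ρ x}, φ x ^ 2 := by
    have huD := hu.continuous_fderiv one_ne_zero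
    rw [hI, ← integral_const_mul, ← integral_const_mul,
      ← integral_add (hint (by fun_prop)) (hint (by fun_prop))]
    refine setIntegral_mono_on (hint (by fun_prop)) (hint (by fun_prop)) hmeas fun x hx => ?_
    have hx0 : 0 < ρ x := hx
    obtain ⟨h1, h2⟩ := hhle k _ hx0.le
    have hB0 : 0 ≤ B := (abs_nonneg _).trans (hhB k 0)
    have b : ‖fderiv ℝ (fun x => h k (ρ x) * φ x) x‖ ≤
        ‖fderiv ℝ φ x‖ * ρ x + |φ x| * (B * G) := by
      rw [fderiv_truncation_mul hρ1 (hh k) hφ]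
      refine (norm_add_le _ _).trans ?_
      rw [norm_smul, norm_smul, Real.norm_eq_abs, Real.norm_eq_abs, abs_mul, abs_of_nonneg h1,
        mul_comm (h k (ρ x)), mul_assoc |φ x|]
      gcongr
      · exact hhB k _
      · exact hGle x hx
    have b2 := pow_le_pow_left₀ (norm_nonneg _) b 2
    have p : 0 ≤ φ x ^ 2 * ρ x ^ q := by positivity
    have := sq_nonneg (‖fderiv ℝ φ x‖ * ρ x - |φ x| * (B * G))
    have e : (|φ x| * (B * G)) ^ 2 = φ x ^ 2 * (B * G) ^ 2 := by rw [mul_pow, sq_abs]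
    nlinarith
  calc _ ≤ _ := hs
    _ ≤ C₂ * (2 * I + 2 * (B * G) ^ 2 * (C₁ * I)) := by
      gcongr
      exact hD.trans (by gcongr; exact hhardy φ hφ)
    _ = C₂ * (2 + 2 * (B * G) ^ 2 * C₁) * I := by ring
    _ ≤ _ := by gcongr; linarith

end WeightedSobolev

/-- Weighted Sobolev inequality (Lemma 4.1 of the paper). -/
theorem stmt5 (n : ℕ) (hn : 1 ≤ n) (Ω : Set (EuclideanSpace ℝ (Fin n)))
    (hΩ : IsSmoothDomain Ω) (p : ℝ) (hp : 1 < p)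
    (hpc : n ≤ 2 ∨ p ≤ ((n : ℝ) + 2) / ((n : ℝ) - 2)) :
    ∃ C : ℝ, 0 < C ∧
      ∀ φ : EuclideanSpace ℝ (Fin n) → ℝ, ContDiff ℝ 1 φ →
        C * (∫ x in Ω, |φ x| ^ (p + 1) * dB Ω x ^ (p + 1)) ^ (2 / (p + 1))
          ≤ ∫ x in Ω, (‖gradient φ x‖ ^ 2 * dB Ω x ^ 2 + φ x ^ 2 * dB Ω x ^ (p + 1)) := by
  obtain ⟨hopen, hbdd, hne, Φ, hΦ, hΩΦ, hfr, hgrad⟩ := hΩ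
  have hfrne : (frontier Ω).Nonempty := by
    have : Nonempty (Fin n) := ⟨⟨0, hn⟩⟩
    refine nonempty_frontier_iff.2 ⟨hne, fun huniv => ?_⟩
    exact NormedSpace.unbounded_univ ℝ (EuclideanSpace ℝ (Fin n)) (huniv ▸ hbdd)
  have hρ : ContDiff ℝ 2 fun x => -Φ x := (contDiff_infty.1 hΦ 2).neg
  have hρ1 : ContDiff ℝ 1 fun x => -Φ x := hρ.of_le (by norm_num)
  have hset : {x | 0 < -Φ x} = Ω := by simp [hΩΦ]
  have hg : ∀ x ∈ closure {x | 0 < -Φ x}, -Φ x = 0 → fderiv ℝ (fun x => -Φ x) x ≠ 0 := by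
    intro x _ hx h0
    have hmem : x ∈ frontier Ω := by rw [hfr]; exact neg_eq_zero.1 hx
    refine hgrad x hmem ?_
    rw [← norm_eq_zero, norm_gradient_eq_norm_fderiv_s5, norm_eq_zero]
    rwa [fderiv_fun_neg, neg_eq_zero] at h0
  have hb : Bornology.IsBounded {x | 0 < -Φ x} := hset ▸ hbdd
  have hq : 2 < p + 1 := by linarith
  have hfinrank : Module.finrank ℝ (EuclideanSpace ℝ (Fin n)) = n := by simp
  have hqc : n ≤ 2 ∨ (2 : ℝ)⁻¹ - (n : ℝ)⁻¹ ≤ (p + 1)⁻¹ := by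
    rcases le_or_gt n 2 with h | h
    · exact Or.inl h
    · right
      have hn2 : (2 : ℝ) < n := by exact_mod_cast h
      have h1 := hpc.resolve_left (by omega)
      rw [le_div_iff₀ (by linarith)] at h1
      rw [inv_sub_inv two_ne_zero (by positivity), inv_eq_one_div,
        div_le_div_iff₀ (by positivity) (by positivity)]
      linarith
  obtain ⟨C, hC, hmain⟩ := exists_setIntegral_mul_rpow_le hρ hb hg (by rwa [hfinrank]) hq
    (by rwa [hfinrank])
  obtain ⟨K, hK, hKle⟩ := exists_infDist_frontier_le_mul hρ1 hb hg
  obtain ⟨L, hL, hLle⟩ := exists_le_mul_infDist_of_contDiff hρ1 hb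
    (hbdd.closure.subset frontier_subset_closure) hfrne
    (fun y hy => by rw [hfr] at hy; exact neg_eq_zero.2 hy)
  rw [hset] at hKle hLle hmain hb
  have hmeas := hopen.measurableSet
  have hd0 : ∀ x, 0 ≤ dB Ω x := fun x => Metric.infDist_nonneg
  have hdc : Continuous (dB Ω) := Metric.continuous_infDist_pt _
  have hq0 : 0 ≤ p + 1 := by linarith
  have hdq : Continuous fun x => dB Ω x ^ (p + 1) := hdc.rpow_const fun _ => Or.inr hq0
  have hρc := hρ1.continuous
  have hρq : Continuous fun x => (-Φ x) ^ (p + 1) := hρc.rpow_const fun _ => Or.inr hq0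
  have hρ0 : ∀ x ∈ Ω, 0 < -Φ x := fun x hx => by rw [← hset] at hx; exact hx
  set A := (K ^ (p + 1)) ^ (2 / (p + 1)) * (C * (L ^ 2 + L ^ (p + 1))) with hA
  have hA0 : 0 < A := by positivity
  refine ⟨A⁻¹, inv_pos.2 hA0, fun φ hφ => ?_⟩
  rw [inv_mul_le_iff₀ hA0]
  have hφc := hφ.continuous
  have hφD : Continuous (fderiv ℝ φ) := hφ.continuous_fderiv one_ne_zero
  have hφq : Continuous fun x => |φ x| ^ (p + 1) :=
    hφc.abs.rpow_const fun _ => Or.inr hq0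
  have hint : ∀ {f : EuclideanSpace ℝ (Fin n) → ℝ}, Continuous f → IntegrableOn f Ω :=
    fun hf => hf.integrableOn_of_isBounded hbdd
  simp only [norm_gradient_eq_norm_fderiv_s5]
  have h1 : ∫ x in Ω, |φ x| ^ (p + 1) * dB Ω x ^ (p + 1) ≤
      K ^ (p + 1) * ∫ x in Ω, |φ x| ^ (p + 1) * (-Φ x) ^ (p + 1) := by
    rw [← integral_const_mul]
    refine setIntegral_mono_on (hint (by fun_prop)) (hint (by fun_prop)) hmeas fun x hx => ?_
    have := Real.rpow_le_rpow (hd0 x) (hKle x hx) hq0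
    rw [Real.mul_rpow hK.le (hρ0 x hx).le] at this
    have := mul_le_mul_of_nonneg_left this (Real.rpow_nonneg (abs_nonneg (φ x)) (p + 1))
    linarith
  have h2 : ∫ x in Ω, (‖fderiv ℝ φ x‖ ^ 2 * (-Φ x) ^ 2 + φ x ^ 2 * (-Φ x) ^ (p + 1)) ≤
      (L ^ 2 + L ^ (p + 1)) *
        ∫ x in Ω, (‖fderiv ℝ φ x‖ ^ 2 * dB Ω x ^ 2 + φ x ^ 2 * dB Ω x ^ (p + 1)) := by
    rw [← integral_const_mul]
    refine setIntegral_mono_on (hint (by fun_prop)) (hint (by fun_prop)) hmeas fun x hx => ?_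
    have a1 := Real.rpow_le_rpow (hρ0 x hx).le (hLle x hx) hq0
    have a2 := pow_le_pow_left₀ (hρ0 x hx).le (hLle x hx) 2
    change _ ≤ (L * dB Ω x) ^ (p + 1) at a1
    change _ ≤ (L * dB Ω x) ^ 2 at a2
    rw [Real.mul_rpow hL.le (hd0 x)] at a1
    rw [mul_pow] at a2
    have b1 := mul_le_mul_of_nonneg_left a1 (sq_nonneg (φ x))
    have b2 := mul_le_mul_of_nonneg_left a2 (sq_nonneg ‖fderiv ℝ φ x‖)
    have hdx := hd0 x
    have p1 : 0 ≤ L ^ (p + 1) * (‖fderiv ℝ φ x‖ ^ 2 * dB Ω x ^ 2) := by positivity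
    have p2 : 0 ≤ L ^ 2 * (φ x ^ 2 * dB Ω x ^ (p + 1)) := by positivity
    linarith
  have hpos : 0 ≤ ∫ x in Ω, |φ x| ^ (p + 1) * (-Φ x) ^ (p + 1) :=
    setIntegral_nonneg hmeas fun x hx => by
      have := hρ0 x hx
      positivity
  calc (∫ x in Ω, |φ x| ^ (p + 1) * dB Ω x ^ (p + 1)) ^ (2 / (p + 1))
      ≤ (K ^ (p + 1) * ∫ x in Ω, |φ x| ^ (p + 1) * (-Φ x) ^ (p + 1)) ^ (2 / (p + 1)) := by
        refine Real.rpow_le_rpow (setIntegral_nonneg hmeas fun x _ => ?_) h1 (by positivity)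
        have := hd0 x
        positivity
    _ = (K ^ (p + 1)) ^ (2 / (p + 1)) *
          (∫ x in Ω, |φ x| ^ (p + 1) * (-Φ x) ^ (p + 1)) ^ (2 / (p + 1)) :=
        Real.mul_rpow (by positivity) hpos
    _ ≤ (K ^ (p + 1)) ^ (2 / (p + 1)) * (C * ((L ^ 2 + L ^ (p + 1)) *
          ∫ x in Ω, (‖fderiv ℝ φ x‖ ^ 2 * dB Ω x ^ 2 + φ x ^ 2 * dB Ω x ^ (p + 1)))) := by
        gcongr
        exact (hmain φ hφ).trans (by gcongr)
    _ = _ := by rw [hA]; ring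
end
end

section
/- Let T > 0, α > 0, μ₁ > 0, μ₂ ∈ [0,1), μ₃ ∈ [0,1], and let ζ : [0,T) → [0,∞) be continuously differentiable and satisfy ζ′(t) ≤ α ζ(t)^{μ₁} ( ζ(t)^{μ₂} + ζ(t)^{μ₃} ) for all t ∈ [0,T). If ∫₀^T ζ(t)^{μ₁} dt < ∞, then there exists a constant C, depending only on α, μ₂, μ₃, ζ(0) and ∫₀^T ζ(t)^{μ₁} dt, such that ζ(t) ≤ C for all t ∈ [0,T). -/
open MeasureTheory Real Set

noncomputable section

theorem rpow_le_one_add {s μ : ℝ} (hs : 0 ≤ s) (h0 : 0 ≤ μ) (h1 : μ ≤ 1) :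
    s ^ μ ≤ 1 + s :=
  calc s ^ μ ≤ (1 + s) ^ μ := Real.rpow_le_rpow hs (by linarith) h0
    _ ≤ (1 + s) ^ (1 : ℝ) := Real.rpow_le_rpow_of_exponent_le (by linarith) h1
    _ = 1 + s := Real.rpow_one _

/-- ODE lemma (Lemma 4.2 of the paper).  The constant `C` depends only on `α`,
`μ₂`, `μ₃`, (an upper bound `Z` for) `ζ(0)` and (an upper bound `I₀` for)
`∫₀^T ζ^{μ₁}`; in particular it does not depend on `T`, `μ₁` or on `ζ` itself. -/
theorem stmt6 (α μ₂ μ₃ Z I₀ : ℝ) (hα : 0 < α)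
    (hμ₂ : μ₂ ∈ Set.Ico (0 : ℝ) 1) (hμ₃ : μ₃ ∈ Set.Icc (0 : ℝ) 1)
    (hZ : 0 ≤ Z) (hI : 0 ≤ I₀) :
    ∃ C : ℝ,
      ∀ (T μ₁ : ℝ) (ζ ζ' : ℝ → ℝ), 0 < T → 0 < μ₁ →
        (∀ t ∈ Set.Ico 0 T, 0 ≤ ζ t) →
        (∀ t ∈ Set.Ico 0 T, HasDerivWithinAt ζ (ζ' t) (Set.Ico 0 T) t) →
        ContinuousOn ζ' (Set.Ico 0 T) →
        (∀ t ∈ Set.Ico 0 T, ζ' t ≤ α * ζ t ^ μ₁ * (ζ t ^ μ₂ + ζ t ^ μ₃)) →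
        IntegrableOn (fun t => ζ t ^ μ₁) (Set.Ico 0 T) →
        ζ 0 ≤ Z →
        (∫ t in Set.Ico 0 T, ζ t ^ μ₁) ≤ I₀ →
        ∀ t ∈ Set.Ico 0 T, ζ t ≤ C := by
  refine ⟨(1 + Z) * Real.exp (2 * α * I₀), ?_⟩
  intro T μ₁ ζ ζ' _ _ hζ hderiv _ hle hint hζ0 hI₀ t ht
  have hsub : Set.Icc 0 t ⊆ Set.Ico 0 T := fun x hx => ⟨hx.1, hx.2.trans_lt ht.2⟩
  have hpos : ∀ x ∈ Set.Ico 0 T, 0 < 1 + ζ x := fun x hx => by linarith [hζ x hx]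
  have hlog : ∀ x ∈ Set.Ico 0 T,
      HasDerivWithinAt (fun x => Real.log (1 + ζ x)) (ζ' x / (1 + ζ x)) (Set.Ico 0 T) x :=
    fun x hx => ((hderiv x hx).const_add 1).log (hpos x hx).ne'
  have hgrowth : Real.log (1 + ζ t) - Real.log (1 + ζ 0) ≤ ∫ x in (0 : ℝ)..t, 2 * α * ζ x ^ μ₁ := by
    refine intervalIntegral.sub_le_integral_of_hasDeriv_right_of_le ht.1
      (g := fun x => Real.log (1 + ζ x)) (g' := fun x => ζ' x / (1 + ζ x))
      (fun x hx => ((hlog x (hsub hx)).mono hsub).continuousWithinAt) ?_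
      ((hint.mono_set hsub).const_mul (2 * α)) ?_
    · intro x hx
      have hx' : x ∈ Set.Ioo 0 T := ⟨hx.1, hx.2.trans ht.2⟩
      exact ((hlog x ⟨hx'.1.le, hx'.2⟩).hasDerivAt
        (Ico_mem_nhds hx'.1 hx'.2)).hasDerivWithinAt
    · intro x hx
      have hx' := hsub ⟨hx.1.le, hx.2.le⟩
      have h0 := hζ x hx'
      rw [div_le_iff₀ (hpos x hx')]
      calc ζ' x ≤ α * ζ x ^ μ₁ * (ζ x ^ μ₂ + ζ x ^ μ₃) := hle x hx'
        _ ≤ α * ζ x ^ μ₁ * ((1 + ζ x) + (1 + ζ x)) := by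
          gcongr
          · exact rpow_le_one_add h0 hμ₂.1 hμ₂.2.le
          · exact rpow_le_one_add h0 hμ₃.1 hμ₃.2
        _ = 2 * α * ζ x ^ μ₁ * (1 + ζ x) := by ring
  have hbound : ∫ x in (0 : ℝ)..t, 2 * α * ζ x ^ μ₁ ≤ 2 * α * I₀ := by
    rw [intervalIntegral.integral_const_mul, intervalIntegral.integral_of_le ht.1]
    gcongr
    refine le_trans (setIntegral_mono_set hint ?_ ?_) hI₀
    · exact ae_restrict_of_forall_mem measurableSet_Ico
        fun x hx => Real.rpow_nonneg (hζ x hx) _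
    · exact (Set.Ioc_subset_Icc_self.trans hsub).eventuallyLE
  have h0 : (0 : ℝ) ∈ Set.Ico 0 T := ⟨le_rfl, ht.1.trans_lt ht.2⟩
  have hlog0 : Real.log (1 + ζ 0) ≤ Real.log (1 + Z) :=
    Real.log_le_log (hpos 0 h0) (by linarith)
  calc ζ t ≤ 1 + ζ t := by linarith
    _ = Real.exp (Real.log (1 + ζ t)) := (Real.exp_log (hpos t ht)).symm
    _ ≤ Real.exp (Real.log (1 + Z) + 2 * α * I₀) := Real.exp_le_exp.mpr (by linarith)
    _ = (1 + Z) * Real.exp (2 * α * I₀) := by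
      rw [Real.exp_add, Real.exp_log (by linarith)]
end
end

section
/- In the fast diffusion setting below, there exists a constant C > 0, depending only on n, Ω, p, b, c₀ and ∫_Ω |∇u(x,0)|² dx (but not on T), such that ∫_Ω ( |∇u(x,t)|² + u(x,t)² ) dx ≤ C for all t ∈ [0,T]. -/
open MeasureTheory Real Set

noncomputable section

/-- Partial derivative in the `i`-th coordinate direction. -/
def pderiv' {n : ℕ} (i : Fin n) (f : EuclideanSpace ℝ (Fin n) → ℝ)
    (x : EuclideanSpace ℝ (Fin n)) : ℝ :=
  fderiv ℝ f x (EuclideanSpace.single i 1)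

/-- The Laplacian `Δf = ∑ᵢ ∂ᵢ∂ᵢ f`. -/
def lap {n : ℕ} (f : EuclideanSpace ℝ (Fin n) → ℝ) (x : EuclideanSpace ℝ (Fin n)) : ℝ :=
  ∑ i, pderiv' i (pderiv' i f) x

/-- A function on `Ω × [0,T]` extends continuously to `closure Ω × [0,T]`. -/
def ExtendsCont {n : ℕ} (Ω : Set (EuclideanSpace ℝ (Fin n))) (T : ℝ)
    (f : EuclideanSpace ℝ (Fin n) → ℝ → ℝ) : Prop :=
  ∃ g : EuclideanSpace ℝ (Fin n) → ℝ → ℝ,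
    ContinuousOn (fun z : EuclideanSpace ℝ (Fin n) × ℝ => g z.1 z.2)
      (closure Ω ×ˢ Set.Icc 0 T) ∧
    ∀ x ∈ Ω, ∀ t ∈ Set.Icc 0 T, g x t = f x t

/-- Membership in `C^{3,2}(closure Ω × [0,T])`, with the first and second time
derivatives recorded as the functions `ut` and `utt`:  `u`, `D_x u`, `D_x² u`,
`D_x³ u`, `∂ₜ u`, `D_x ∂ₜ u`, `D_x² ∂ₜ u`, `∂ₜ² u` all extend continuously to
`closure Ω × [0,T]`. -/
def C32 {n : ℕ} (Ω : Set (EuclideanSpace ℝ (Fin n))) (T : ℝ)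
    (u ut utt : EuclideanSpace ℝ (Fin n) → ℝ → ℝ) : Prop :=
  (∀ t ∈ Set.Icc (0 : ℝ) T, ContDiffOn ℝ 3 (fun x => u x t) Ω) ∧
  (∀ t ∈ Set.Icc (0 : ℝ) T, ContDiffOn ℝ 2 (fun x => ut x t) Ω) ∧
  (∀ x ∈ Ω, ∀ t ∈ Set.Icc (0 : ℝ) T, HasDerivWithinAt (u x) (ut x t) (Set.Icc 0 T) t) ∧
  (∀ x ∈ Ω, ∀ t ∈ Set.Icc (0 : ℝ) T, HasDerivWithinAt (ut x) (utt x t) (Set.Icc 0 T) t) ∧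
  ContinuousOn (fun z : EuclideanSpace ℝ (Fin n) × ℝ => u z.1 z.2)
    (closure Ω ×ˢ Set.Icc 0 T) ∧
  ContinuousOn (fun z : EuclideanSpace ℝ (Fin n) × ℝ => ut z.1 z.2)
    (closure Ω ×ˢ Set.Icc 0 T) ∧
  ContinuousOn (fun z : EuclideanSpace ℝ (Fin n) × ℝ => utt z.1 z.2)
    (closure Ω ×ˢ Set.Icc 0 T) ∧
  (∀ i : Fin n, ExtendsCont Ω T fun x t => pderiv' i (fun y => u y t) x) ∧
  (∀ i j : Fin n, ExtendsCont Ω T fun x t => pderiv' i (pderiv' j fun y => u y t) x) ∧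
  (∀ i j k : Fin n,
    ExtendsCont Ω T fun x t => pderiv' i (pderiv' j (pderiv' k fun y => u y t)) x) ∧
  (∀ i : Fin n, ExtendsCont Ω T fun x t => pderiv' i (fun y => ut y t) x) ∧
  (∀ i j : Fin n, ExtendsCont Ω T fun x t => pderiv' i (pderiv' j fun y => ut y t) x)

/-- The fast diffusion setting of Section 4 of the paper: `u ∈ C^{3,2}(closure Ω × [0,T])`
is positive in `Ω × [0,T]`, solves `∂ₜ(u^p) = Δu + bu + u^p` in `Ω × (0,T]`, vanishes
on `∂Ω × [0,T]`, and is comparable to the distance to the boundary. -/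
def FDSetting {n : ℕ} (Ω : Set (EuclideanSpace ℝ (Fin n))) (p b T c₀ : ℝ)
    (u ut utt : EuclideanSpace ℝ (Fin n) → ℝ → ℝ) : Prop :=
  IsSmoothDomain Ω ∧ 1 < p ∧ (n ≤ 2 ∨ p ≤ ((n : ℝ) + 2) / ((n : ℝ) - 2)) ∧
  0 < T ∧ 1 ≤ c₀ ∧
  C32 Ω T u ut utt ∧
  (∀ x ∈ Ω, ∀ t ∈ Set.Icc (0 : ℝ) T, 0 < u x t) ∧
  (∀ x ∈ Ω, ∀ t ∈ Set.Ioc (0 : ℝ) T,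
      HasDerivWithinAt (fun s => u x s ^ p)
        (lap (fun y => u y t) x + b * u x t + u x t ^ p) (Set.Icc 0 T) t) ∧
  (∀ x ∈ frontier Ω, ∀ t ∈ Set.Icc (0 : ℝ) T, u x t = 0) ∧
  (∀ x ∈ Ω, ∀ t ∈ Set.Icc (0 : ℝ) T,
      c₀⁻¹ * dB Ω x ≤ u x t ∧ u x t ≤ c₀ * dB Ω x)

/-- The integral of a partial derivative of a compactly supported `C¹` function vanishes. -/
lemma integral_pderiv'_eq_zero {n : ℕ} (i : Fin n) {H : EuclideanSpace ℝ (Fin n) → ℝ}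
    (hH : ContDiff ℝ 1 H) (hc : HasCompactSupport H) : ∫ x, pderiv' i H x = 0 := by
  have hd : Continuous (fun x => fderiv ℝ H x (EuclideanSpace.single i 1)) :=
    (hH.continuous_fderiv one_ne_zero).clm_apply continuous_const
  have hdc : HasCompactSupport (fun x => fderiv ℝ H x (EuclideanSpace.single i 1)) :=
    hc.fderiv_apply ℝ _
  have key := integral_mul_fderiv_eq_neg_fderiv_mul_of_integrable (μ := volume)
    (f := fun _ : EuclideanSpace ℝ (Fin n) => (1 : ℝ)) (g := H) (𝕜 := ℝ)
    (v := EuclideanSpace.single i 1) (by simp)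
    (by simpa using hd.integrable_of_hasCompactSupport hdc)
    (by simpa using hH.continuous.integrable_of_hasCompactSupport hc)
    (fun _ _ => differentiableAt_const _) (fun x _ => (hH.differentiable one_ne_zero) x)
  simpa [pderiv'] using key

/-- A `C¹` cutoff function on the line, with bounded derivative. -/
lemma exists_cutoff : ∃ (χ : ℝ → ℝ) (B : ℝ), ContDiff ℝ 1 χ ∧ (∀ s ≤ 1, χ s = 0) ∧
    (∀ s, 2 ≤ s → χ s = 1) ∧ (∀ s, |χ s| ≤ 1) ∧ (∀ s, 2 < s → deriv χ s = 0) ∧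
    (∀ s, 0 ≤ s → |deriv χ s| * s ≤ B) := by
  have hχ : ContDiff ℝ 1 (fun s : ℝ => Real.smoothTransition (s - 1)) :=
    Real.smoothTransition.contDiff.comp (contDiff_id.sub contDiff_const)
  have hone : ∀ s : ℝ, 2 ≤ s → Real.smoothTransition (s - 1) = 1 := fun s hs =>
    Real.smoothTransition.one_of_one_le (by linarith)
  have hder : ∀ s : ℝ, 2 < s → deriv (fun s : ℝ => Real.smoothTransition (s - 1)) s = 0 := by
    intro s hs
    have : (fun s : ℝ => Real.smoothTransition (s - 1)) =ᶠ[nhds s] fun _ => 1 := by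
      filter_upwards [lt_mem_nhds hs] with y hy using hone y hy.le
    rw [this.deriv_eq, deriv_const]
  obtain ⟨B, hB⟩ := (isCompact_Icc (a := (0 : ℝ)) (b := 2)).exists_bound_of_continuousOn
    (((hχ.continuous_deriv le_rfl).mul continuous_id).continuousOn)
  refine ⟨_, max B 0, hχ, fun s hs => Real.smoothTransition.zero_of_nonpos (by linarith), hone,
    fun s => ?_, hder, fun s hs => ?_⟩
  · rw [abs_of_nonneg (Real.smoothTransition.nonneg _)]
    exact Real.smoothTransition.le_one _
  · rcases le_or_gt s 2 with h | h
    · have := hB s ⟨hs, h⟩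
      rw [Real.norm_eq_abs, Pi.mul_apply, abs_mul, id, abs_of_nonneg hs] at this
      exact this.trans (le_max_left _ _)
    · rw [hder s h]
      simp

/-- Divergence theorem for a `C¹` function dominated near the boundary by a positive `C¹`
function `w` which vanishes there. -/
lemma setIntegral_pderiv'_eq_zero {n : ℕ} (i : Fin n) {Ω : Set (EuclideanSpace ℝ (Fin n))}
    (hO : IsOpen Ω) (hb : Bornology.IsBounded Ω) {w h : EuclideanSpace ℝ (Fin n) → ℝ}
    {c M M' : ℝ} (hw : ContDiffOn ℝ 1 w Ω) (hwc : ContinuousOn w (closure Ω))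
    (hw0 : ∀ x ∈ frontier Ω, w x = 0) (hwpos : ∀ x ∈ Ω, 0 < w x)
    (hwM : ∀ x ∈ Ω, |pderiv' i w x| ≤ M) (hh : ContDiffOn ℝ 1 h Ω)
    (hhw : ∀ x ∈ Ω, |h x| ≤ c * w x) (hhM : ∀ x ∈ Ω, |pderiv' i h x| ≤ M') :
    ∫ x in Ω, pderiv' i h x = 0 := by
  obtain ⟨χ, B, hχ, hχ0, hχ1, hχb, hχd, hχB⟩ := exists_cutoff
  let F : ℕ → EuclideanSpace ℝ (Fin n) → ℝ := fun k =>
    Ω.indicator fun x => χ (((k : ℝ) + 1) * w x) * h x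
  let K : ℕ → Set (EuclideanSpace ℝ (Fin n)) := fun k =>
    closure Ω ∩ {x | 1 ≤ ((k : ℝ) + 1) * w x}
  have hKcl : ∀ k, IsClosed (K k) := fun k =>
    (continuousOn_const.mul hwc).preimage_isClosed_of_isClosed isClosed_closure isClosed_Ici
  have hKc : ∀ k, IsCompact (K k) := fun k =>
    hb.isCompact_closure.of_isClosed_subset (hKcl k) inter_subset_left
  have hKΩ : ∀ k, K k ⊆ Ω := by
    rintro k x ⟨hx, hx1⟩
    by_contra hxΩ
    have : x ∈ frontier Ω := ⟨hx, by rwa [hO.interior_eq]⟩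
    simp only [mem_ofPred_eq, hw0 x this] at hx1
    linarith
  have hF0 : ∀ k, ∀ x ∉ K k, F k x = 0 := by
    intro k x hx
    by_cases hxΩ : x ∈ Ω
    · have : ((k : ℝ) + 1) * w x ≤ 1 := by
        by_contra! hlt
        exact hx ⟨subset_closure hxΩ, hlt.le⟩
      simp [F, hxΩ, hχ0 _ this]
    · simp [F, hxΩ]
  have hFev0 : ∀ k, ∀ x ∉ Ω, F k =ᶠ[nhds x] fun _ => 0 := fun k x hx => by
    filter_upwards [(hKcl k).isOpen_compl.mem_nhds fun h => hx (hKΩ k h)] with y hy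
    exact hF0 k y hy
  have hFev : ∀ k, ∀ x ∈ Ω, F k =ᶠ[nhds x] fun x => χ (((k : ℝ) + 1) * w x) * h x :=
    fun k x hx => by
      filter_upwards [hO.mem_nhds hx] with y hy
      simp [F, hy]
  have hwat : ∀ x ∈ Ω, ContDiffAt ℝ 1 w x := fun x hx => hw.contDiffAt (hO.mem_nhds hx)
  have hhat : ∀ x ∈ Ω, ContDiffAt ℝ 1 h x := fun x hx => hh.contDiffAt (hO.mem_nhds hx)
  have hFC : ∀ k, ContDiff ℝ 1 (F k) := by
    intro k
    rw [contDiff_iff_contDiffAt]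
    intro x
    by_cases hx : x ∈ Ω
    · refine ContDiffAt.congr_of_eventuallyEq ?_ (hFev k x hx)
      exact (hχ.contDiffAt.comp x (contDiffAt_const.mul (hwat x hx))).mul (hhat x hx)
    · exact contDiffAt_const.congr_of_eventuallyEq (hFev0 k x hx)
  have hFint : ∀ k, ∫ x in Ω, pderiv' i (F k) x = 0 := by
    intro k
    rw [setIntegral_eq_integral_of_forall_compl_eq_zero,
      integral_pderiv'_eq_zero i (hFC k) (HasCompactSupport.intro (hKc k) (hF0 k))]
    intro x hx
    simp [pderiv', (hFev0 k x hx).fderiv_eq]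
  have hFd : ∀ k, ∀ x ∈ Ω, pderiv' i (F k) x = χ (((k : ℝ) + 1) * w x) * pderiv' i h x +
      h x * (deriv χ (((k : ℝ) + 1) * w x) * (((k : ℝ) + 1) * pderiv' i w x)) := by
    intro k x hx
    have hwd := ((hwat x hx).differentiableAt one_ne_zero).hasFDerivAt
    have hhd := ((hhat x hx).differentiableAt one_ne_zero).hasFDerivAt
    have hχd := ((hχ.differentiable one_ne_zero) (((k : ℝ) + 1) * w x)).hasDerivAt
    have := (hχd.comp_hasFDerivAt x (hwd.const_mul ((k : ℝ) + 1))).mul hhd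
    rw [pderiv', (hFev k x hx).fderiv_eq]
    erw [this.fderiv]
    simp [pderiv']
  have hlim := tendsto_integral_of_dominated_convergence (μ := volume.restrict Ω)
    (F := fun k => pderiv' i (F k)) (f := pderiv' i h) (fun _ => M' + c * B * M)
    (fun k => (((hFC k).continuous_fderiv one_ne_zero).clm_apply
      continuous_const).aestronglyMeasurable)
    (by
      have : IsFiniteMeasure (volume.restrict Ω) := ⟨by simpa using hb.measure_lt_top⟩
      exact integrable_const _)
    (by
      intro k
      filter_upwards [ae_restrict_mem hO.measurableSet] with x hx
      rw [hFd k x hx, Real.norm_eq_abs]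
      have hk : (0 : ℝ) < (k : ℝ) + 1 := by positivity
      have hM : 0 ≤ M := (abs_nonneg _).trans (hwM x hx)
      have hc : 0 ≤ c := by
        have := (abs_nonneg _).trans (hhw x hx)
        exact nonneg_of_mul_nonneg_left this (hwpos x hx)
      have h1 : |χ (((k : ℝ) + 1) * w x) * pderiv' i h x| ≤ 1 * M' := by
        rw [abs_mul]
        exact mul_le_mul (hχb _) (hhM x hx) (abs_nonneg _) zero_le_one
      have h2 := hχB (((k : ℝ) + 1) * w x) (mul_nonneg hk.le (hwpos x hx).le)
      have h3 : |h x * (deriv χ (((k : ℝ) + 1) * w x) * (((k : ℝ) + 1) * pderiv' i w x))|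
          ≤ c * B * M := by
        rw [abs_mul, abs_mul, abs_mul, abs_of_pos hk]
        calc _ ≤ (c * w x) * (|deriv χ (((k : ℝ) + 1) * w x)| * (((k : ℝ) + 1) * M)) := by
              gcongr
              · exact mul_nonneg hc (hwpos x hx).le
              · exact hhw x hx
              · exact hwM x hx
          _ = c * (|deriv χ (((k : ℝ) + 1) * w x)| * (((k : ℝ) + 1) * w x)) * M := by ring
          _ ≤ _ := by gcongr
      linarith [abs_add_le (χ (((k : ℝ) + 1) * w x) * pderiv' i h x)
        (h x * (deriv χ (((k : ℝ) + 1) * w x) * (((k : ℝ) + 1) * pderiv' i w x)))])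
    (by
      filter_upwards [ae_restrict_mem hO.measurableSet] with x hx
      refine tendsto_const_nhds.congr' ?_
      have : Filter.Tendsto (fun k : ℕ => ((k : ℝ) + 1) * w x) Filter.atTop Filter.atTop :=
        (Filter.tendsto_atTop_add_const_right _ _ tendsto_natCast_atTop_atTop).atTop_mul_const
          (hwpos x hx)
      filter_upwards [this.eventually_gt_atTop 2] with k hk
      rw [hFd k x hx, hχ1 _ hk.le, hχd _ hk]
      ring)
  simp only [hFint] at hlim
  exact (tendsto_nhds_unique hlim tendsto_const_nhds)

namespace ExtendsCont

variable {n : ℕ} {Ω : Set (EuclideanSpace ℝ (Fin n))} {T : ℝ}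
  {f g : EuclideanSpace ℝ (Fin n) → ℝ → ℝ}

lemma of_continuousOn
    (hf : ContinuousOn (fun z : EuclideanSpace ℝ (Fin n) × ℝ => f z.1 z.2)
      (closure Ω ×ˢ Set.Icc 0 T)) : ExtendsCont Ω T f :=
  ⟨f, hf, fun _ _ _ _ => rfl⟩

lemma const (c : ℝ) : ExtendsCont Ω T fun _ _ => c :=
  of_continuousOn continuousOn_const

lemma add (hf : ExtendsCont Ω T f) (hg : ExtendsCont Ω T g) :
    ExtendsCont Ω T fun x t => f x t + g x t := by
  obtain ⟨F, hF, hFf⟩ := hf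
  obtain ⟨G, hG, hGg⟩ := hg
  exact ⟨fun x t => F x t + G x t, hF.add hG, fun x hx t ht => by
    simp only [hFf x hx t ht, hGg x hx t ht]⟩

lemma sub (hf : ExtendsCont Ω T f) (hg : ExtendsCont Ω T g) :
    ExtendsCont Ω T fun x t => f x t - g x t := by
  obtain ⟨F, hF, hFf⟩ := hf
  obtain ⟨G, hG, hGg⟩ := hg
  exact ⟨fun x t => F x t - G x t, hF.sub hG, fun x hx t ht => by
    simp only [hFf x hx t ht, hGg x hx t ht]⟩

lemma mul (hf : ExtendsCont Ω T f) (hg : ExtendsCont Ω T g) :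
    ExtendsCont Ω T fun x t => f x t * g x t := by
  obtain ⟨F, hF, hFf⟩ := hf
  obtain ⟨G, hG, hGg⟩ := hg
  exact ⟨fun x t => F x t * G x t, hF.mul hG, fun x hx t ht => by
    simp only [hFf x hx t ht, hGg x hx t ht]⟩

lemma pow (hf : ExtendsCont Ω T f) (k : ℕ) : ExtendsCont Ω T fun x t => f x t ^ k := by
  obtain ⟨F, hF, hFf⟩ := hf
  exact ⟨fun x t => F x t ^ k, hF.pow k, fun x hx t ht => by simp only [hFf x hx t ht]⟩

lemma rpow_const (hf : ExtendsCont Ω T f) {q : ℝ} (hq : 0 ≤ q) :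
    ExtendsCont Ω T fun x t => f x t ^ q := by
  obtain ⟨F, hF, hFf⟩ := hf
  exact ⟨fun x t => F x t ^ q, hF.rpow_const fun _ _ => Or.inr hq,
    fun x hx t ht => by simp only [hFf x hx t ht]⟩

lemma sum {ι : Type*} {s : Finset ι} {f : ι → EuclideanSpace ℝ (Fin n) → ℝ → ℝ}
    (hf : ∀ i, ExtendsCont Ω T (f i)) : ExtendsCont Ω T fun x t => ∑ i ∈ s, f i x t := by
  choose F hF hFf using hf
  exact ⟨fun x t => ∑ i ∈ s, F i x t, continuousOn_finsetSum _ fun i _ => hF i,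
    fun x hx t ht => Finset.sum_congr rfl fun i _ => hFf i x hx t ht⟩

/-- Freezing the time variable. -/
lemma freeze (hf : ExtendsCont Ω T f) {s : ℝ} (hs : s ∈ Set.Icc 0 T) :
    ExtendsCont Ω T fun x _ => f x s := by
  obtain ⟨F, hF, hFf⟩ := hf
  refine ⟨fun x _ => F x s, ?_, fun x hx t _ => hFf x hx s hs⟩
  exact hF.comp (f := fun z : EuclideanSpace ℝ (Fin n) × ℝ => (z.1, s)) (by fun_prop)
    fun z hz => ⟨hz.1, hs⟩

lemma continuousOn_time (hf : ExtendsCont Ω T f) {x : EuclideanSpace ℝ (Fin n)} (hx : x ∈ Ω) :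
    ContinuousOn (f x) (Set.Icc 0 T) := by
  obtain ⟨F, hF, hFf⟩ := hf
  have : ContinuousOn (F x) (Set.Icc 0 T) :=
    hF.comp (f := fun t : ℝ => (x, t)) (by fun_prop) fun t ht => ⟨subset_closure hx, ht⟩
  exact this.congr fun t ht => (hFf x hx t ht).symm

lemma integrableOn (hf : ExtendsCont Ω T f) (hO : IsOpen Ω) (hb : Bornology.IsBounded Ω) {t : ℝ}
    (ht : t ∈ Set.Icc 0 T) : IntegrableOn (fun x => f x t) Ω := by
  obtain ⟨F, hF, hFf⟩ := hf
  have : ContinuousOn (fun x => F x t) (closure Ω) :=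
    hF.comp (f := fun x => (x, t)) (by fun_prop) fun x hx => ⟨hx, ht⟩
  exact ((this.integrableOn_compact hb.isCompact_closure).mono_set subset_closure).congr_fun
    (fun x hx => hFf x hx t ht) hO.measurableSet

lemma exists_bound (hf : ExtendsCont Ω T f) (hb : Bornology.IsBounded Ω) :
    ∃ M, 0 ≤ M ∧ ∀ x ∈ Ω, ∀ t ∈ Set.Icc 0 T, |f x t| ≤ M := by
  obtain ⟨F, hF, hFf⟩ := hf
  obtain ⟨M, hM⟩ := (hb.isCompact_closure.prod isCompact_Icc).exists_bound_of_continuousOn hF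
  refine ⟨max M 0, le_max_right _ _, fun x hx t ht => ?_⟩
  rw [← hFf x hx t ht]
  exact (hM (x, t) ⟨subset_closure hx, ht⟩).trans (le_max_left _ _)

end ExtendsCont

lemma norm_gradient_sq {n : ℕ} (f : EuclideanSpace ℝ (Fin n) → ℝ)
    (x : EuclideanSpace ℝ (Fin n)) : ‖gradient f x‖ ^ 2 = ∑ i, pderiv' i f x ^ 2 := by
  rw [EuclideanSpace.norm_sq_eq]
  refine Finset.sum_congr rfl fun i _ => ?_
  have : pderiv' i f x = gradient f x i := by
    have h := EuclideanSpace.inner_single_right (𝕜 := ℝ) i 1 (gradient f x)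
    rw [gradient, InnerProductSpace.toDual_symm_apply] at h
    simpa [gradient, pderiv'] using h
  rw [this, Real.norm_eq_abs, sq_abs]

/-- Twice the energy density of the fast diffusion equation. -/
def energyDensity {n : ℕ} (p b : ℝ) (u : EuclideanSpace ℝ (Fin n) → ℝ → ℝ)
    (x : EuclideanSpace ℝ (Fin n)) (t : ℝ) : ℝ :=
  ∑ i, pderiv' i (fun y => u y t) x ^ 2 - b * u x t ^ 2 - 2 / (p + 1) * u x t ^ (p + 1)

/-- The increment of `energyDensity` between two times, up to terms of divergence form. -/
def energyIncrement {n : ℕ} (p b : ℝ) (u : EuclideanSpace ℝ (Fin n) → ℝ → ℝ) (s : ℝ)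
    (x : EuclideanSpace ℝ (Fin n)) (t : ℝ) : ℝ :=
  -((u x t - u x s) *
    (lap (fun y => u y t) x + lap (fun y => u y s) x + b * (u x t + u x s))) -
    2 / (p + 1) * (u x t ^ (p + 1) - u x s ^ (p + 1))

section Energy

variable {n : ℕ} {Ω : Set (EuclideanSpace ℝ (Fin n))} {p b T c₀ : ℝ}
  {u ut utt : EuclideanSpace ℝ (Fin n) → ℝ → ℝ}

lemma C32.extendsCont_lap (h : C32 Ω T u ut utt) :
    ExtendsCont Ω T fun x t => lap (fun y => u y t) x := by
  obtain ⟨-, -, -, -, -, -, -, -, hD2, -⟩ := h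
  exact ExtendsCont.sum fun i => hD2 i i

lemma C32.extendsCont_energyDensity (h : C32 Ω T u ut utt) (hp : 1 < p) (b : ℝ) :
    ExtendsCont Ω T (energyDensity p b u) := by
  obtain ⟨-, -, -, -, hu, -, -, hD, -⟩ := h
  have hu := ExtendsCont.of_continuousOn hu
  exact ((ExtendsCont.sum fun i => (hD i).pow 2).sub ((ExtendsCont.const b).mul (hu.pow 2))).sub
    ((ExtendsCont.const _).mul (hu.rpow_const (by linarith)))

lemma C32.extendsCont_energyIncrement (h : C32 Ω T u ut utt) (hp : 1 < p) (b : ℝ) {s : ℝ}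
    (hs : s ∈ Set.Icc 0 T) : ExtendsCont Ω T (energyIncrement p b u s) := by
  have hl := h.extendsCont_lap
  obtain ⟨-, -, -, -, hu, -⟩ := h
  have hu := ExtendsCont.of_continuousOn hu
  have hq := hu.rpow_const (q := p + 1) (by linarith)
  have h1 := (hu.sub (hu.freeze hs)).mul ((hl.add (hl.freeze hs)).add
    ((ExtendsCont.const b).mul (hu.add (hu.freeze hs))))
  have h2 := ((ExtendsCont.const 0).sub h1).sub
    ((ExtendsCont.const (2 / (p + 1))).mul (hq.sub (hq.freeze hs)))
  simp only [zero_sub] at h2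
  exact h2

lemma FDSetting.integral_energyDensity_sub (h : FDSetting Ω p b T c₀ u ut utt) {s t : ℝ}
    (hs : s ∈ Set.Icc 0 T) (ht : t ∈ Set.Icc 0 T) :
    (∫ x in Ω, energyDensity p b u x t) - ∫ x in Ω, energyDensity p b u x s =
      ∫ x in Ω, energyIncrement p b u s x t := by
  obtain ⟨⟨hO, hb, -⟩, hp, -, hT, hc₀, hC, hpos, hpde, hbd, hcmp⟩ := h
  have he := hC.extendsCont_energyDensity hp b
  have hR := (hC.extendsCont_energyIncrement hp b hs).integrableOn hO hb ht
  obtain ⟨hu3, -, -, -, hu, -, -, hD, hD2, -⟩ := hC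
  have hu' := ExtendsCont.of_continuousOn hu
  have hdiff : ∀ τ ∈ Set.Icc 0 T, ∀ x ∈ Ω, ContDiffAt ℝ 3 (fun y => u y τ) x :=
    fun τ hτ x hx => (hu3 τ hτ).contDiffAt (hO.mem_nhds hx)
  have hpd : ∀ i, ∀ τ ∈ Set.Icc 0 T, ∀ x ∈ Ω, ContDiffAt ℝ 1 (pderiv' i fun y => u y τ) x :=
    fun i τ hτ x hx =>
      (((hdiff τ hτ x hx).of_le (by norm_num : (2 : WithTop ℕ∞) ≤ 3)).fderiv_right
        (m := 1) (by norm_num)).clm_apply contDiffAt_const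
  let q : Fin n → EuclideanSpace ℝ (Fin n) → ℝ := fun i x =>
    (u x t - u x s) * (pderiv' i (fun y => u y t) x + pderiv' i (fun y => u y s) x)
  have hder : ∀ i, ∀ x ∈ Ω, pderiv' i (q i) x =
      (pderiv' i (fun y => u y t) x - pderiv' i (fun y => u y s) x) *
        (pderiv' i (fun y => u y t) x + pderiv' i (fun y => u y s) x) +
      (u x t - u x s) * (pderiv' i (pderiv' i fun y => u y t) x +
        pderiv' i (pderiv' i fun y => u y s) x) := by
    intro i x hx
    have d1 := ((hdiff t ht x hx).differentiableAt (by norm_num)).hasFDerivAt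
    have d2 := ((hdiff s hs x hx).differentiableAt (by norm_num)).hasFDerivAt
    have d3 := ((hpd i t ht x hx).differentiableAt one_ne_zero).hasFDerivAt
    have d4 := ((hpd i s hs x hx).differentiableAt one_ne_zero).hasFDerivAt
    rw [pderiv']
    erw [((d1.sub d2).mul (d3.add d4)).fderiv]
    simp only [add_apply, sub_apply,
      smul_apply, smul_eq_mul, Pi.add_apply, Pi.sub_apply]
    simp only [pderiv']
    ring
  have hext : ∀ i, ExtendsCont Ω T fun x τ =>
      (pderiv' i (fun y => u y τ) x - pderiv' i (fun y => u y s) x) *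
        (pderiv' i (fun y => u y τ) x + pderiv' i (fun y => u y s) x) +
      (u x τ - u x s) * (pderiv' i (pderiv' i fun y => u y τ) x +
        pderiv' i (pderiv' i fun y => u y s) x) := fun i =>
    (((hD i).sub ((hD i).freeze hs)).mul ((hD i).add ((hD i).freeze hs))).add
      ((hu'.sub (hu'.freeze hs)).mul ((hD2 i i).add ((hD2 i i).freeze hs)))
  have hzero : ∀ i, ∫ x in Ω, pderiv' i (q i) x = 0 := by
    intro i
    obtain ⟨M, hM0, hM⟩ := (hD i).exists_bound hb
    obtain ⟨M', -, hM'⟩ := (hext i).exists_bound hb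
    refine setIntegral_pderiv'_eq_zero (w := fun x => u x s) (c := c₀ ^ 2 * (M + M)) (M := M)
      (M' := M') i hO hb ((hu3 s hs).of_le (by norm_num)) ?_ (fun x hx => hbd x hx s hs)
      (fun x hx => hpos x hx s hs) (fun x hx => hM x hx s hs) ?_ (fun x hx => ?_)
      (fun x hx => ?_)
    · exact hu.comp (f := fun x => (x, s)) (by fun_prop) fun x hx => ⟨hx, hs⟩
    · intro x hx
      exact ((((hdiff t ht x hx).sub (hdiff s hs x hx)).of_le (by norm_num)).mul
        ((hpd i t ht x hx).add (hpd i s hs x hx))).contDiffWithinAt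
    · have hle : u x t ≤ c₀ ^ 2 * u x s := by
        have h1 := (hcmp x hx t ht).2
        have h2 := (hcmp x hx s hs).1
        rw [inv_mul_le_iff₀ (by linarith)] at h2
        nlinarith
      have h1 : |u x t - u x s| ≤ c₀ ^ 2 * u x s := by
        have := hpos x hx t ht
        have := hpos x hx s hs
        have : 1 ≤ c₀ ^ 2 := one_le_pow₀ hc₀
        rw [abs_le]
        constructor <;> nlinarith
      have h2 : |pderiv' i (fun y => u y t) x + pderiv' i (fun y => u y s) x| ≤ M + M :=
        (abs_add_le _ _).trans (add_le_add (hM x hx t ht) (hM x hx s hs))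
      calc |q i x| = |u x t - u x s| *
            |pderiv' i (fun y => u y t) x + pderiv' i (fun y => u y s) x| := abs_mul _ _
        _ ≤ (c₀ ^ 2 * u x s) * (M + M) :=
            mul_le_mul h1 h2 (abs_nonneg _) ((abs_nonneg _).trans h1)
        _ = _ := by ring
    · rw [hder i x hx]
      exact hM' x hx t ht
  have hsum : ∫ x in Ω, ∑ i, pderiv' i (q i) x = 0 := by
    rw [integral_finsetSum]
    · simp [hzero]
    · intro i _
      exact ((hext i).integrableOn hO hb ht).congr_fun (fun x hx => (hder i x hx).symm)
        hO.measurableSet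
  rw [← sub_eq_zero, ← integral_sub (he.integrableOn hO hb ht) (he.integrableOn hO hb hs),
    ← integral_sub (f := fun x => energyDensity p b u x t - energyDensity p b u x s)
      ((he.integrableOn hO hb ht).sub (he.integrableOn hO hb hs)) hR, ← hsum]
  refine setIntegral_congr_fun hO.measurableSet fun x hx => ?_
  simp only [hder _ x hx, energyDensity, energyIncrement, lap, Finset.sum_add_distrib,
    ← Finset.mul_sum]
  have : ∑ i, (pderiv' i (fun y => u y t) x - pderiv' i (fun y => u y s) x) *
        (pderiv' i (fun y => u y t) x + pderiv' i (fun y => u y s) x) =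
      ∑ i, pderiv' i (fun y => u y t) x ^ 2 - ∑ i, pderiv' i (fun y => u y s) x ^ 2 := by
    rw [← Finset.sum_sub_distrib]
    exact Finset.sum_congr rfl fun i _ => by ring
  rw [this]
  ring

lemma FDSetting.hasDerivWithinAt_energy (h : FDSetting Ω p b T c₀ u ut utt) {s : ℝ}
    (hs : s ∈ Set.Icc 0 T) :
    HasDerivWithinAt (fun t => ∫ x in Ω, energyDensity p b u x t)
      (∫ x in Ω, -2 * (ut x s * (lap (fun y => u y s) x + b * u x s + u x s ^ p)))
      (Set.Icc 0 T) s := by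
  have hdiff := fun t (ht : t ∈ Set.Icc 0 T) => h.integral_energyDensity_sub hs ht
  obtain ⟨⟨hO, hb, -⟩, hp, -, hT, hc₀, hC, hpos, hpde, hbd, hcmp⟩ := h
  have hl := hC.extendsCont_lap
  have hR := hC.extendsCont_energyIncrement hp b hs
  obtain ⟨-, -, hut, -, hu, hutc, -⟩ := hC
  have hu := ExtendsCont.of_continuousOn hu
  have hutc := ExtendsCont.of_continuousOn hutc
  have hp1 : p + 1 ≠ 0 := by linarith
  have hpow : ∀ x ∈ Ω, ∀ t ∈ Set.Icc 0 T, HasDerivWithinAt (fun τ => u x τ ^ (p + 1))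
      (ut x t * (p + 1) * u x t ^ p) (Set.Icc 0 T) t := fun x hx t ht => by
    simpa using (hut x hx t ht).rpow_const (p := p + 1) (Or.inl (hpos x hx t ht).ne')
  have hF := (hl.add (hl.freeze hs)).add ((ExtendsCont.const b).mul (hu.add (hu.freeze hs)))
  have hq := (hutc.mul (ExtendsCont.const (p + 1))).mul (hu.rpow_const (q := p) (by linarith))
  obtain ⟨M₁, hM₁0, hM₁⟩ := hutc.exists_bound hb
  obtain ⟨M₂, hM₂0, hM₂⟩ := hF.exists_bound hb
  obtain ⟨M₃, hM₃0, hM₃⟩ := hq.exists_bound hb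
  have hslope : ∀ {f f' : ℝ → ℝ} {M : ℝ},
      (∀ t ∈ Set.Icc 0 T, HasDerivWithinAt f (f' t) (Set.Icc 0 T) t) →
      (∀ t ∈ Set.Icc 0 T, |f' t| ≤ M) → ∀ t ∈ Set.Icc 0 T \ {s}, |slope f s t| ≤ M := by
    intro f f' M hf hM t ht
    have := Convex.norm_image_sub_le_of_norm_hasDerivWithin_le hf hM (convex_Icc 0 T) hs ht.1
    rw [slope_def_field, abs_div, div_le_iff₀ (abs_pos.2 (sub_ne_zero.2 ht.2))]
    exact this
  have hinc : ∀ x t, (t - s)⁻¹ * energyIncrement p b u s x t =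
      -(slope (u x) s t * (lap (fun y => u y t) x + lap (fun y => u y s) x +
        b * (u x t + u x s))) - 2 / (p + 1) * slope (fun τ => u x τ ^ (p + 1)) s t := by
    intro x t
    simp only [energyIncrement, slope_def_field]
    ring
  rw [hasDerivWithinAt_iff_tendsto_slope]
  have hlim : Filter.Tendsto (fun t => ∫ x in Ω, (t - s)⁻¹ * energyIncrement p b u s x t)
      (nhdsWithin s (Set.Icc 0 T \ {s}))
      (nhds (∫ x in Ω, -2 * (ut x s * (lap (fun y => u y s) x + b * u x s + u x s ^ p)))) := by
    refine tendsto_integral_filter_of_dominated_convergence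
      (fun _ => M₁ * M₂ + |2 / (p + 1)| * M₃) ?_ ?_ ?_ ?_
    · filter_upwards [self_mem_nhdsWithin] with t ht
      exact ((hR.integrableOn hO hb ht.1).const_mul _).aestronglyMeasurable
    · filter_upwards [self_mem_nhdsWithin] with t ht
      filter_upwards [ae_restrict_mem hO.measurableSet] with x hx
      rw [hinc, Real.norm_eq_abs]
      refine (abs_sub _ _).trans ?_
      rw [abs_neg, abs_mul, abs_mul]
      gcongr
      · exact hslope (hut x hx) (hM₁ x hx) t ht
      · exact hM₂ x hx t ht.1
      · exact hslope (hpow x hx) (hM₃ x hx) t ht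
    · have : IsFiniteMeasure (volume.restrict Ω) := ⟨by simpa using hb.measure_lt_top⟩
      exact integrable_const _
    · filter_upwards [ae_restrict_mem hO.measurableSet] with x hx
      simp only [hinc]
      have h1 := hasDerivWithinAt_iff_tendsto_slope.1 (hut x hx s hs)
      have h2 := hasDerivWithinAt_iff_tendsto_slope.1 (hpow x hx s hs)
      have h3 : Filter.Tendsto _ (nhdsWithin s (Set.Icc 0 T \ {s})) _ :=
        ((hF.continuousOn_time hx) s hs).mono_left (nhdsWithin_mono _ sdiff_subset)
      convert ((h1.mul h3).neg.sub (h2.const_mul (2 / (p + 1)))) using 2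
      field_simp
      ring
  refine hlim.congr' ?_
  filter_upwards [self_mem_nhdsWithin] with t ht
  rw [integral_const_mul, ← hdiff t ht.1, slope_def_field, div_eq_inv_mul]

lemma FDSetting.antitoneOn_energy (h : FDSetting Ω p b T c₀ u ut utt) :
    AntitoneOn (fun t => ∫ x in Ω, energyDensity p b u x t) (Set.Icc 0 T) := by
  have hd := fun s (hs : s ∈ Set.Icc 0 T) => h.hasDerivWithinAt_energy hs
  obtain ⟨⟨hO, -⟩, hp, -, hT, -, ⟨-, -, hut, -⟩, hpos, hpde, -⟩ := h
  refine antitoneOn_of_deriv_nonpos (convex_Icc 0 T) (fun s hs => (hd s hs).continuousWithinAt)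
    (fun s hs => ((hd s (interior_subset hs)).mono interior_subset).differentiableWithinAt) ?_
  intro s hs
  have hs' := interior_subset hs
  rw [((hd s hs').hasDerivAt (mem_interior_iff_mem_nhds.1 hs)).deriv]
  rw [interior_Icc] at hs
  refine setIntegral_nonpos hO.measurableSet fun x hx => ?_
  have h1 := (hut x hx s hs').rpow_const (p := p) (Or.inl (hpos x hx s hs').ne')
  rw [← (uniqueDiffOn_Icc hT s hs').eq_deriv _ h1 (hpde x hx s ⟨hs.1, hs.2.le⟩)]
  have h2 : 0 ≤ u x s ^ (p - 1) := Real.rpow_nonneg (hpos x hx s hs').le _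
  have h3 : 0 ≤ ut x s ^ 2 * p * u x s ^ (p - 1) := by positivity
  nlinarith

end Energy

/-- Uniform `H¹` bound (Proposition 4.1 of the paper).  The constant depends only on
`n`, `Ω`, `p`, `b`, `c₀` and (an upper bound `E` for) `∫_Ω |∇u(·,0)|²`, but not
on `T`. -/
theorem stmt7 (n : ℕ) (hn : 1 ≤ n) (Ω : Set (EuclideanSpace ℝ (Fin n)))
    (p b c₀ E : ℝ) :
    ∃ C : ℝ, 0 < C ∧
      ∀ (T : ℝ) (u ut utt : EuclideanSpace ℝ (Fin n) → ℝ → ℝ),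
        FDSetting Ω p b T c₀ u ut utt →
        (∫ x in Ω, ‖gradient (fun y => u y 0) x‖ ^ 2) ≤ E →
        ∀ t ∈ Set.Icc (0 : ℝ) T,
          (∫ x in Ω, (‖gradient (fun y => u y t) x‖ ^ 2 + u x t ^ 2)) ≤ C := by
  set M : ℝ := |c₀| * Metric.diam Ω
  have hM0 : 0 ≤ M := by positivity
  set A : ℝ := |b| * M ^ 2 + 2 * M ^ (p + 1) + M ^ 2
  have hA0 : 0 ≤ A := by positivity
  refine ⟨|E| + (|b| * M ^ 2 + A) * volume.real Ω + 1, by positivity, ?_⟩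
  intro T u ut utt h hE t ht
  have hanti := h.antitoneOn_energy (left_mem_Icc.2 (ht.1.trans ht.2)) ht ht.1
  obtain ⟨⟨hO, hb, -⟩, hp, -, hT, hc₀, hC, hpos, -, -, hcmp⟩ := h
  have he := hC.extendsCont_energyDensity hp b
  obtain ⟨-, -, -, -, hu, -, -, hD, -⟩ := hC
  have hu := ExtendsCont.of_continuousOn hu
  have hG : ExtendsCont Ω T fun x t => ‖gradient (fun y => u y t) x‖ ^ 2 := by
    simpa only [norm_gradient_sq] using ExtendsCont.sum fun i => (hD i).pow 2
  have h0 : (0 : ℝ) ∈ Set.Icc 0 T := left_mem_Icc.2 hT.le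
  have hdB : ∀ x ∈ Ω, dB Ω x ≤ Metric.diam Ω := by
    intro x hx
    rcases (frontier Ω).eq_empty_or_nonempty with hf | ⟨y, hy⟩
    · simp [dB, hf, Metric.diam_nonneg]
    · rw [← Metric.diam_closure]
      exact (Metric.infDist_le_dist_of_mem hy).trans
        (Metric.dist_le_diam_of_mem hb.closure (subset_closure hx) (frontier_subset_closure hy))
  have huM : ∀ x ∈ Ω, ∀ s ∈ Set.Icc 0 T, u x s ≤ M := fun x hx s hs =>
    (hcmp x hx s hs).2.trans
      (mul_le_mul (le_abs_self _) (hdB x hx) Metric.infDist_nonneg (abs_nonneg _))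
  have hbu : ∀ x ∈ Ω, ∀ s ∈ Set.Icc 0 T, |b * u x s ^ 2| ≤ |b| * M ^ 2 := by
    intro x hx s hs
    have := (hpos x hx s hs).le
    rw [abs_mul, abs_of_nonneg (sq_nonneg (u x s))]
    gcongr
    exact huM x hx s hs
  have hvol : volume Ω ≠ ⊤ := hb.measure_lt_top.ne
  have hconst : ∀ c : ℝ, ∫ _ in Ω, c = c * volume.real Ω := fun c => by simp [mul_comm]
  have hci : ∀ c : ℝ, IntegrableOn (fun _ => c) Ω := fun c => integrableOn_const hvol
  have hupper : ∫ x in Ω, (‖gradient (fun y => u y t) x‖ ^ 2 + u x t ^ 2) ≤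
      (∫ x in Ω, energyDensity p b u x t) + A * volume.real Ω := by
    rw [← hconst, ← integral_add (he.integrableOn hO hb ht) (hci A)]
    refine setIntegral_mono_on ((hG.add (hu.pow 2)).integrableOn hO hb ht)
      ((he.integrableOn hO hb ht).add (hci A)) hO.measurableSet fun x hx => ?_
    have hup := (hpos x hx t ht).le
    have h1 := (abs_le.1 (hbu x hx t ht)).2
    have h2 : u x t ^ 2 ≤ M ^ 2 := pow_le_pow_left₀ hup (huM x hx t ht) 2
    have h3 : 2 / (p + 1) * u x t ^ (p + 1) ≤ 2 * M ^ (p + 1) := by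
      gcongr
      · rw [div_le_iff₀] <;> linarith
      · exact huM x hx t ht
    rw [norm_gradient_sq, energyDensity]
    linarith
  have hlower : (∫ x in Ω, energyDensity p b u x 0) ≤
      (∫ x in Ω, ‖gradient (fun y => u y 0) x‖ ^ 2) + |b| * M ^ 2 * volume.real Ω := by
    rw [← hconst, ← integral_add (hG.integrableOn hO hb h0) (hci _)]
    refine setIntegral_mono_on (he.integrableOn hO hb h0)
      ((hG.integrableOn hO hb h0).add (hci _)) hO.measurableSet fun x hx => ?_
    have hup := (hpos x hx 0 h0).le
    have h1 := (abs_le.1 (hbu x hx 0 h0)).1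
    have h3 : 0 ≤ 2 / (p + 1) * u x 0 ^ (p + 1) := by positivity
    rw [norm_gradient_sq, energyDensity]
    linarith
  simp only at hanti
  linarith [le_abs_self E]
end
end
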